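/- arXiv:2305.02154 — 2 statements merged into one kernel-verified Lean document; each statement's English description precedes it below -/
import Mathlib

section
/- Let H be a finite group acting transitively on a finite set X with |X| = n ≥ 2, and let s₁,…,s_d be chosen independently and uniformly at random from H. Let M be the normalized adjacency matrix of the resulting Schreier graph of degree 2d, and let μ₂ be its second largest eigenvalue in absolute value (its eigenvalues are real and, ordered by absolute value, the largest is μ₁ = 1). Then E(|μ₂|) ≤ e·√((ln n)/d), where e is the base of the natural logarithm. -/
open scoped BigOperators

namespace RandomSchreier

/-- The trace of a power of a real symmetric matrix is the power sum of its eigenvalues. -/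
lemma trace_pow_eq_sum_eigenvalues {X : Type*} [Fintype X] [DecidableEq X]
    {A : Matrix X X ℝ} (hA : A.IsHermitian) (m : ℕ) :
    (A ^ m).trace = ∑ x, hA.eigenvalues x ^ m := by
  conv_lhs => rw [hA.spectral_theorem, ← map_pow, Unitary.conjStarAlgAut_apply,
    Matrix.trace_mul_cycle, Unitary.coe_star_mul_self, one_mul, Matrix.diagonal_pow]
  simp [Matrix.trace_diagonal]

section ActionMatrix

variable {H X : Type*} [Group H] [DecidableEq X] [MulAction H X]

/-- The permutation matrix by which `g` acts on functions on `X`. -/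
def actionMatrix (X : Type*) [DecidableEq X] [MulAction H X] (g : H) : Matrix X X ℝ :=
  Matrix.of fun x y => if x = g • y then 1 else 0

lemma actionMatrix_apply (g : H) (x y : X) :
    actionMatrix X g x y = if x = g • y then 1 else 0 := rfl

lemma actionMatrix_one : actionMatrix X (1 : H) = 1 := by
  ext x y
  simp [actionMatrix_apply, Matrix.one_apply]

variable [Fintype X]

lemma actionMatrix_mul (g h : H) :
    actionMatrix X (g * h) = actionMatrix X g * actionMatrix X h := by
  ext x y
  simp [actionMatrix_apply, Matrix.mul_apply, mul_smul]

lemma trace_actionMatrix_le (g : H) : (actionMatrix X g).trace ≤ Fintype.card X := by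
  calc (actionMatrix X g).trace ≤ ∑ _x : X, (1 : ℝ) := by
        refine Finset.sum_le_sum fun x _ => ?_
        rw [Matrix.diag_apply, actionMatrix_apply]
        split_ifs <;> norm_num
    _ = Fintype.card X := by simp

lemma actionMatrix_mul_const (g : H) (c : ℝ) :
    actionMatrix X g * Matrix.of (fun _ _ => c) = Matrix.of (fun _ _ : X => c) := by
  ext x y
  have hx (z : X) : (x = g • z) ↔ (g⁻¹ • x = z) := inv_smul_eq_iff.symm
  simp [actionMatrix_apply, Matrix.mul_apply, hx]

lemma const_mul_actionMatrix (g : H) (c : ℝ) :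
    Matrix.of (fun _ _ => c) * actionMatrix X g = Matrix.of (fun _ _ : X => c) := by
  ext x y
  simp [actionMatrix_apply, Matrix.mul_apply]

variable [Fintype H]

/-- Averaging the permutation matrices of a transitive action gives the uniform matrix. -/
lemma sum_actionMatrix [MulAction.IsPretransitive H X] :
    ∑ h : H, actionMatrix X h =
      Matrix.of fun _ _ => (Fintype.card H : ℝ) / Fintype.card X := by
  have key : ∀ x x' y : X, (∑ h : H, actionMatrix X h) x y = (∑ h : H, actionMatrix X h) x' y := by
    intro x x' y
    obtain ⟨g, rfl⟩ := MulAction.exists_smul_eq H x x'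
    rw [Matrix.sum_apply, Matrix.sum_apply]
    refine Fintype.sum_equiv (Equiv.mulLeft g) _ _ fun h => ?_
    simp [actionMatrix_apply, mul_smul]
  ext x y
  have hX : (Fintype.card X : ℝ) ≠ 0 := by
    have : Nonempty X := ⟨x⟩
    exact_mod_cast Fintype.card_ne_zero
  have hsum : ∑ z : X, (∑ h : H, actionMatrix X h) z y = Fintype.card H := by
    simp_rw [Matrix.sum_apply]
    rw [Finset.sum_comm]
    simp [actionMatrix_apply]
  rw [Finset.sum_congr rfl fun z _ => key z x y] at hsum
  rw [Matrix.of_apply, eq_div_iff hX, ← hsum]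
  simp [mul_comm]

end ActionMatrix

section Words

variable {H : Type*} [Group H] {d : ℕ}

/-- The element of `H` named by a letter: a generator `s i` or its inverse. -/
def letter (s : Fin d → H) (a : Fin d × Bool) : H :=
  bif a.2 then s a.1 else (s a.1)⁻¹

/-- The element of `H` named by a word in the generators `s i` and their inverses. -/
def wordEval (s : Fin d → H) (l : List (Fin d × Bool)) : H :=
  (l.map (letter s)).prod

lemma wordEval_cons (s : Fin d → H) (a : Fin d × Bool) (l : List (Fin d × Bool)) :
    wordEval s (a :: l) = letter s a * wordEval s l := by
  simp [wordEval]

lemma letter_mul_mulSingle_of_ne (s : Fin d → H) {i : Fin d} (h : H) {a : Fin d × Bool}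
    (ha : a.1 ≠ i) : letter (s * Pi.mulSingle i h) a = letter s a := by
  simp [letter, Pi.mulSingle_eq_of_ne ha]

lemma wordEval_mul_mulSingle_of_notMem (s : Fin d → H) {i : Fin d} (h : H)
    {l : List (Fin d × Bool)} (hl : i ∉ l.map Prod.fst) :
    wordEval (s * Pi.mulSingle i h) l = wordEval s l := by
  unfold wordEval
  congr 1
  refine List.map_congr_left fun a ha => letter_mul_mulSingle_of_ne s h ?_
  rintro rfl
  exact hl (List.mem_map_of_mem ha)

variable {X : Type*} [DecidableEq X] [MulAction H X]

lemma eq_smul_sum_actionMatrix {d : ℕ} (s : Fin d → H) (A : Matrix X X ℝ)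
    (hA : ∀ x y, A x y = (((Finset.univ.filter fun i : Fin d => s i • x = y).card : ℝ)
      + ((Finset.univ.filter fun i : Fin d => (s i)⁻¹ • x = y).card : ℝ)) / (2 * d)) :
    A = (2 * d : ℝ)⁻¹ • ∑ a, actionMatrix X (letter s a) := by
  ext x y
  rw [hA, Matrix.smul_apply, Matrix.sum_apply, Fintype.sum_prod_type]
  simp only [Fintype.sum_bool, letter, actionMatrix_apply, cond_true, cond_false,
    Finset.sum_add_distrib, ← inv_smul_eq_iff, inv_inv, smul_eq_mul]
  simp only [Finset.sum_boole]
  ring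

variable [Fintype X]

lemma sum_letter_pow (s : Fin d → H) (m : ℕ) :
    (∑ a, actionMatrix X (letter s a)) ^ m =
      ∑ w : Fin m → Fin d × Bool, actionMatrix X (wordEval s (List.ofFn w)) := by
  induction m with
  | zero => simp [wordEval, actionMatrix_one]
  | succ m ih =>
    rw [pow_succ', ih, Finset.sum_mul_sum, ← Finset.sum_product']
    refine Fintype.sum_equiv (Fin.consEquiv fun _ => Fin d × Bool) _ _ fun p => ?_
    simp [Fin.consEquiv, List.ofFn_succ, wordEval_cons, actionMatrix_mul]

variable [Fintype H]

lemma sum_trace_wordEval_le (l : List (Fin d × Bool)) :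
    ∑ s : Fin d → H, (actionMatrix X (wordEval s l)).trace ≤
      (Fintype.card X : ℝ) * (Fintype.card H : ℝ) ^ d := by
  calc _ ≤ ∑ _s : Fin d → H, (Fintype.card X : ℝ) :=
        Finset.sum_le_sum fun s _ => trace_actionMatrix_le _
    _ = _ := by simp [mul_comm]

lemma sum_mul_right_eq {G : Type*} [Group G] [Fintype G] (g : G) (F : G → ℝ) :
    ∑ s, F (s * g) = ∑ s, F s :=
  Equiv.sum_comp (Equiv.mulRight g) F

variable [MulAction.IsPretransitive H X]

lemma sum_actionMatrix_letter (s : Fin d → H) (a : Fin d × Bool) :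
    ∑ h : H, actionMatrix X (letter (s * Pi.mulSingle a.1 h) a) =
      Matrix.of fun _ _ => (Fintype.card H : ℝ) / Fintype.card X := by
  rw [← sum_actionMatrix (H := H) (X := X)]
  obtain ⟨i, b⟩ := a
  cases b
  · refine Fintype.sum_equiv ((Equiv.mulLeft (s i)).trans (Equiv.inv H)) _ _ fun h => ?_
    simp [letter]
  · refine Fintype.sum_equiv (Equiv.mulLeft (s i)) _ _ fun h => ?_
    simp [letter]

/-- Averaging over a generator which occurs exactly once in a word gives the uniform matrix. -/
lemma sum_actionMatrix_wordEval (s : Fin d → H) (i : Fin d) :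
    ∀ l : List (Fin d × Bool), (l.map Prod.fst).count i = 1 →
      ∑ h : H, actionMatrix X (wordEval (s * Pi.mulSingle i h) l) =
        Matrix.of fun _ _ => (Fintype.card H : ℝ) / Fintype.card X
  | [], hl => by simp at hl
  | a :: l, hl => by
    simp_rw [wordEval_cons, actionMatrix_mul]
    rw [List.map_cons, List.count_cons] at hl
    by_cases ha : a.1 = i
    · subst ha
      have hl' : a.1 ∉ l.map Prod.fst := List.count_eq_zero.1 (by simpa using hl)
      simp_rw [wordEval_mul_mulSingle_of_notMem s _ hl']
      rw [← Finset.sum_mul, sum_actionMatrix_letter, const_mul_actionMatrix]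
    · simp_rw [letter_mul_mulSingle_of_ne s _ ha]
      rw [← Finset.mul_sum, sum_actionMatrix_wordEval s i l (by simpa [ha] using hl),
        actionMatrix_mul_const]

lemma sum_trace_wordEval_of_count_eq_one [Nonempty X] {i : Fin d} {l : List (Fin d × Bool)}
    (hl : (l.map Prod.fst).count i = 1) :
    ∑ s : Fin d → H, (actionMatrix X (wordEval s l)).trace = (Fintype.card H : ℝ) ^ d := by
  have hX : (Fintype.card X : ℝ) ≠ 0 := by exact_mod_cast Fintype.card_ne_zero
  have hH : (Fintype.card H : ℝ) ≠ 0 := by exact_mod_cast Fintype.card_ne_zero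
  refine mul_left_cancel₀ hH ?_
  calc (Fintype.card H : ℝ) * ∑ s : Fin d → H, (actionMatrix X (wordEval s l)).trace
      = ∑ h : H, ∑ s : Fin d → H,
          (actionMatrix X (wordEval (s * Pi.mulSingle i h) l)).trace := by
        have hshift (h : H) : ∑ s : Fin d → H,
            (actionMatrix X (wordEval (s * Pi.mulSingle i h) l)).trace =
              ∑ s : Fin d → H, (actionMatrix X (wordEval s l)).trace :=
          sum_mul_right_eq _ (fun s => (actionMatrix X (wordEval s l)).trace)
        rw [Finset.sum_congr rfl fun h _ => hshift h, Finset.sum_const, Finset.card_univ,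
          nsmul_eq_mul]
    _ = ∑ _s : Fin d → H, (Fintype.card H : ℝ) := by
        rw [Finset.sum_comm]
        refine Finset.sum_congr rfl fun s _ => ?_
        rw [← Matrix.trace_sum, sum_actionMatrix_wordEval s i l hl]
        simp [Matrix.trace, mul_div_cancel₀ _ hX]
    _ = _ := by simp [mul_comm]

end Words

section Counting

/-- The words in which no generator occurs exactly once. -/
def singletonFree (d m : ℕ) : Finset (Fin m → Fin d × Bool) :=
  Finset.univ.filter fun w => ∀ i, ((List.ofFn w).map Prod.fst).count i ≠ 1

lemma exists_support_of_mem_singletonFree {d k : ℕ} (hk : k ≤ d)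
    {w : Fin (2 * k) → Fin d × Bool} (hw : w ∈ singletonFree d (2 * k)) :
    ∃ S ∈ Finset.powersetCard k (Finset.univ : Finset (Fin d)), ∀ j, (w j).1 ∈ S := by
  rw [singletonFree, Finset.mem_filter] at hw
  set l := (List.ofFn w).map Prod.fst with hl
  have hlen : l.length = 2 * k := by simp [hl]
  have hcard : l.toFinset.card ≤ k := by
    have h2 : ∑ _i ∈ l.toFinset, 2 ≤ ∑ i ∈ l.toFinset, l.count i := by
      refine Finset.sum_le_sum fun i hi => ?_
      have h1 := hw.2 i
      have h0 := List.count_pos_iff.2 (List.mem_toFinset.1 hi)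
      omega
    rw [List.sum_toFinset_count_eq_length, hlen, Finset.sum_const, smul_eq_mul] at h2
    omega
  obtain ⟨S, hS, -, hSk⟩ := Finset.exists_subsuperset_card_eq (Finset.subset_univ l.toFinset)
    hcard (by simpa using hk)
  refine ⟨S, by simp [hSk], fun j => hS ?_⟩
  rw [List.mem_toFinset, hl, List.mem_map]
  exact ⟨w j, List.mem_ofFn.2 ⟨j, rfl⟩, rfl⟩

lemma card_singletonFree_le {d k : ℕ} (hk : k ≤ d) :
    (singletonFree d (2 * k)).card ≤ d.choose k * (k * 2) ^ (2 * k) := by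
  classical
  have hsub : singletonFree d (2 * k) ⊆
      (Finset.powersetCard k (Finset.univ : Finset (Fin d))).biUnion
        fun S => Fintype.piFinset fun _ => S ×ˢ (Finset.univ : Finset Bool) := by
    intro w hw
    obtain ⟨S, hS, hwS⟩ := exists_support_of_mem_singletonFree hk hw
    exact Finset.mem_biUnion.2 ⟨S, hS, by simpa [Fintype.mem_piFinset] using hwS⟩
  refine (Finset.card_le_card hsub).trans (Finset.card_biUnion_le.trans ?_)
  rw [Finset.sum_congr rfl (g := fun _ => (k * 2) ^ (2 * k))]
  · simp
  · intro S hS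
    simp [Fintype.card_piFinset, (Finset.mem_powersetCard.1 hS).2]

end Counting

section Moments

variable {H X : Type*} [Group H] [Fintype H] [Fintype X] [DecidableEq X] [MulAction H X]
  [MulAction.IsPretransitive H X] [Nonempty X]

lemma sum_trace_pow_le {d : ℕ} (m : ℕ) :
    ∑ s : Fin d → H, ((∑ a, actionMatrix X (letter s a)) ^ m).trace ≤
      ((2 * d : ℝ) ^ m + (singletonFree d m).card * Fintype.card X) *
        (Fintype.card H : ℝ) ^ d := by
  simp_rw [sum_letter_pow, Matrix.trace_sum]
  rw [Finset.sum_comm]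
  calc _ ≤ ∑ w : Fin m → Fin d × Bool, ((Fintype.card H : ℝ) ^ d +
        if w ∈ singletonFree d m then (Fintype.card X : ℝ) * (Fintype.card H : ℝ) ^ d else 0) := by
        refine Finset.sum_le_sum fun w _ => ?_
        split_ifs with hw
        · exact (sum_trace_wordEval_le _).trans (le_add_of_nonneg_left (by positivity))
        · simp only [singletonFree, Finset.mem_filter, Finset.mem_univ, true_and, not_forall,
            not_not] at hw
          obtain ⟨i, hi⟩ := hw
          rw [sum_trace_wordEval_of_count_eq_one hi, add_zero]
    _ = _ := by
        rw [Finset.sum_add_distrib, ← Finset.sum_filter]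
        simp
        ring

/-- The moment bound behind the expectation estimate. -/
lemma sum_trace_normalized_pow_le {d k : ℕ} (hd : 0 < d) (hk : k ≤ d) :
    ∑ s : Fin d → H,
        (((2 * d : ℝ)⁻¹ • ∑ a, actionMatrix X (letter s a)) ^ (2 * k)).trace ≤
      (1 + Fintype.card X * (k : ℝ) ^ (2 * k) / (k.factorial * (d : ℝ) ^ k)) *
        (Fintype.card H : ℝ) ^ d := by
  have hd' : (0 : ℝ) < d := by exact_mod_cast hd
  have hcard : ((singletonFree d (2 * k)).card : ℝ) ≤
      (d : ℝ) ^ k / k.factorial * (k * 2) ^ (2 * k) := by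
    calc ((singletonFree d (2 * k)).card : ℝ) ≤ (d.choose k : ℝ) * (k * 2) ^ (2 * k) := by
          exact_mod_cast card_singletonFree_le hk
      _ ≤ _ := by gcongr; exact Nat.choose_le_pow_div k d
  simp_rw [smul_pow, Matrix.trace_smul, smul_eq_mul]
  rw [← Finset.mul_sum]
  calc _ ≤ ((2 * d : ℝ)⁻¹) ^ (2 * k) *
        (((2 * d : ℝ) ^ (2 * k) + (d : ℝ) ^ k / k.factorial * (k * 2) ^ (2 * k) *
          Fintype.card X) * (Fintype.card H : ℝ) ^ d) := by
        gcongr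
        refine (sum_trace_pow_le _).trans ?_
        gcongr
    _ = _ := by
        have hfac : (k.factorial : ℝ) ≠ 0 := by exact_mod_cast k.factorial_ne_zero
        rw [inv_pow, mul_pow, mul_pow, pow_mul' (d : ℝ) 2 k]
        field_simp

end Moments

section Numerics

open Real

lemma exp_div_two_mul_pow_le_factorial {k : ℕ} (hk : 1 ≤ k) :
    exp 1 / 2 * (k / exp 1) ^ k ≤ (k.factorial : ℝ) := by
  refine le_trans ?_ (Stirling.le_factorial_stirling k)
  gcongr
  have hk' : (1 : ℝ) ≤ k := by exact_mod_cast hk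
  have h := exp_one_lt_d9
  have hp := pi_gt_three
  refine le_sqrt_of_sq_le ?_
  have : (exp 1 / 2) ^ 2 ≤ 2 := by nlinarith [exp_pos 1]
  nlinarith

lemma exp_mul_pow_le {L : ℝ} {k : ℕ} (hk : 1 ≤ k) (hkL : k ≤ L) (hLk : L ≤ k + 1) :
    exp L * (k : ℝ) ^ (2 * k) ≤ (exp 1 ^ 2 * L) ^ k * k.factorial := by
  have hk0 : (0 : ℝ) < k := by exact_mod_cast hk
  obtain ⟨t, rfl⟩ : ∃ t, L = k + t := ⟨L - k, by ring⟩
  have ht0 : 0 ≤ t := by linarith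
  have ht1 : t ≤ 1 := by linarith
  have hbern : 1 + t ≤ (1 + t / k) ^ k := by
    have := one_add_mul_le_pow (a := t / k) (by have := div_nonneg ht0 hk0.le; linarith) k
    rwa [mul_div_cancel₀ _ hk0.ne'] at this
  have hexp : exp t ≤ exp 1 / 2 * (1 + t) := by
    have h1 : exp t ≤ (1 - t) * exp 0 + t * exp 1 := by
      have := convexOn_exp.2 (Set.mem_univ 0) (Set.mem_univ 1) (by linarith : 0 ≤ 1 - t) ht0
        (by ring)
      simpa using this
    rw [exp_zero] at h1
    have := exp_one_gt_d9
    nlinarith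
  have hfac := exp_div_two_mul_pow_le_factorial hk
  have hL : ((k : ℝ) + t) ^ k = (k : ℝ) ^ k * (1 + t / k) ^ k := by
    rw [← mul_pow]; congr 1; field_simp
  have hek : exp (k : ℝ) = exp 1 ^ k := by rw [← exp_nat_mul, mul_one]
  calc exp (k + t) * (k : ℝ) ^ (2 * k)
      = exp 1 ^ k * (k : ℝ) ^ (2 * k) * exp t := by rw [exp_add, hek]; ring
    _ ≤ exp 1 ^ k * (k : ℝ) ^ (2 * k) * (exp 1 / 2 * (1 + t)) := by gcongr
    _ ≤ exp 1 ^ k * (k : ℝ) ^ (2 * k) * (exp 1 / 2 * (1 + t / k) ^ k) := by gcongr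
    _ = (exp 1 ^ 2 * (k + t)) ^ k * (exp 1 / 2 * (k / exp 1) ^ k) := by
        rw [mul_pow, hL, div_pow]; field_simp; ring
    _ ≤ _ := by gcongr

/-- An integer exponent close to `log n` for which the moment bound is strong enough. -/
lemma exists_exponent {n : ℕ} (hn : 2 ≤ n) :
    ∃ k : ℕ, 1 ≤ k ∧ (k : ℝ) ≤ exp 1 ^ 2 * log n ∧
      (n : ℝ) * (k : ℝ) ^ (2 * k) ≤ (exp 1 ^ 2 * log n) ^ k * k.factorial := by
  have hn' : (2 : ℝ) ≤ n := by exact_mod_cast hn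
  have hlog : log 2 ≤ log n := log_le_log (by norm_num) hn'
  have hlog2 := log_two_gt_d9
  have he := exp_one_gt_d9
  have hexp : exp (log n) = n := exp_log (by linarith)
  rcases le_or_gt 1 (log n) with h | h
  · have hk : 1 ≤ ⌊log n⌋₊ := Nat.le_floor (by simpa using h)
    have hfloor := Nat.floor_le (show 0 ≤ log n by linarith)
    refine ⟨⌊log n⌋₊, hk, ?_, ?_⟩
    · have h1 : 1 ≤ exp 1 ^ 2 := by nlinarith
      nlinarith
    · have := exp_mul_pow_le hk hfloor (Nat.lt_floor_add_one _).le
      rwa [hexp] at this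
  · have hne : (n : ℝ) ≤ exp 1 := by rw [← hexp]; exact exp_le_exp.2 h.le
    have h1 : exp 1 ≤ exp 1 ^ 2 * log n := by nlinarith
    exact ⟨1, le_rfl, by push_cast; linarith, by simpa using hne.trans h1⟩

end Numerics

end RandomSchreier

/-- Let `H` be a finite group acting transitively on a finite set `X`
with `|X| = n ≥ 2`, and let `s₁, …, s_d` be independent uniform random elements of `H`.
Let `M s` be the normalized adjacency matrix of the resulting degree-`2d` Schreier graph,
and let `μ s 1` be its second largest eigenvalue in absolute value (eigenvalues listed
with multiplicity, ordered by decreasing absolute value, the first one being `1`).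
Then `E(|μ₂|) ≤ e·√((ln n)/d)`. -/
theorem stmt0
    {H X : Type*} [Group H] [Fintype H] [Fintype X] [DecidableEq X]
    [MulAction H X] (htrans : MulAction.IsPretransitive H X)
    {n : ℕ} (hn : Fintype.card X = n) (hn2 : 2 ≤ n)
    {d : ℕ} (hd : 0 < d)
    (M : (Fin d → H) → Matrix X X ℝ)
    (hM : ∀ s x y, M s x y =
      (((Finset.univ.filter fun i : Fin d => s i • x = y).card : ℝ)
        + ((Finset.univ.filter fun i : Fin d => (s i)⁻¹ • x = y).card : ℝ)) / (2 * d))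
    (μ : (Fin d → H) → Fin n → ℝ)
    (hμ : ∀ s : Fin d → H, ∃ hsym : (M s).IsHermitian, ∃ e : Fin n ≃ X,
      (∀ i, μ s i = hsym.eigenvalues (e i)) ∧
      (∀ i j : Fin n, i ≤ j → |μ s j| ≤ |μ s i|) ∧
      μ s ⟨0, by omega⟩ = 1) :
    (∑ s : Fin d → H, |μ s ⟨1, by omega⟩|) / (Fintype.card H : ℝ) ^ d
      ≤ Real.exp 1 * Real.sqrt (Real.log n / d) := by
  have hX : Nonempty X := Fintype.card_pos_iff.1 (by omega)
  have hd' : (0 : ℝ) < d := by exact_mod_cast hd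
  have hH : (0 : ℝ) < (Fintype.card H : ℝ) ^ d := by
    have : (0 : ℝ) < Fintype.card H := by exact_mod_cast Fintype.card_pos
    positivity
  obtain ⟨k, hk1, hkL, hkn⟩ := RandomSchreier.exists_exponent hn2
  set L := Real.exp 1 ^ 2 * Real.log n with hL
  have hk0 : (1 : ℝ) ≤ k := by exact_mod_cast hk1
  have hrhs : Real.exp 1 * Real.sqrt (Real.log n / d) = Real.sqrt (L / d) := by
    rw [hL, mul_div_assoc, Real.sqrt_mul (by positivity), Real.sqrt_sq (Real.exp_pos 1).le]
  rw [hrhs]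
  rcases lt_or_ge d k with hdk | hkd
  · have hle : ∀ s, |μ s ⟨1, by omega⟩| ≤ 1 := by
      intro s
      obtain ⟨-, -, -, hanti, h0⟩ := hμ s
      simpa [h0] using hanti ⟨0, by omega⟩ ⟨1, by omega⟩ (by simp)
    calc _ ≤ (1 : ℝ) := by
          rw [div_le_one hH]
          exact (Finset.sum_le_sum fun s _ => hle s).trans (by simp)
      _ ≤ _ := by
          rw [Real.one_le_sqrt, one_le_div hd']
          have : (d : ℝ) ≤ k := by exact_mod_cast hdk.le
          linarith
  · have htrace : ∀ s, 1 + |μ s ⟨1, by omega⟩| ^ (2 * k) ≤ (M s ^ (2 * k)).trace := by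
      intro s
      obtain ⟨hsym, e, he, -, h0⟩ := hμ s
      rw [RandomSchreier.trace_pow_eq_sum_eigenvalues hsym, ← Equiv.sum_comp e]
      simp_rw [← he]
      have hne : (⟨0, by omega⟩ : Fin n) ≠ ⟨1, by omega⟩ := by simp
      calc _ = ∑ i ∈ {(⟨0, by omega⟩ : Fin n), ⟨1, by omega⟩}, μ s i ^ (2 * k) := by
            rw [Finset.sum_pair hne, h0, one_pow, (even_two_mul k).pow_abs]
        _ ≤ _ := Finset.sum_le_sum_of_subset_of_nonneg (Finset.subset_univ _)
            fun i _ _ => (even_two_mul k).pow_nonneg _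
    have hmoment : (∑ s, |μ s ⟨1, by omega⟩| ^ (2 * k)) / (Fintype.card H : ℝ) ^ d ≤
        n * (k : ℝ) ^ (2 * k) / (k.factorial * (d : ℝ) ^ k) := by
      have h1 := RandomSchreier.sum_trace_normalized_pow_le (H := H) (X := X) hd hkd
      simp_rw [← fun s => RandomSchreier.eq_smul_sum_actionMatrix s (M s) (hM s), hn] at h1
      have h2 := (Finset.sum_le_sum fun s _ => htrace s).trans h1
      rw [Finset.sum_add_distrib] at h2
      simp only [Finset.sum_const, Finset.card_univ, Fintype.card_pi_const, nsmul_eq_mul, mul_one,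
        Nat.cast_pow] at h2
      rw [div_le_iff₀ hH]
      linarith
    have hjensen : ((∑ s, |μ s ⟨1, by omega⟩|) / (Fintype.card H : ℝ) ^ d) ^ (2 * k) ≤
        (∑ s, |μ s ⟨1, by omega⟩| ^ (2 * k)) / (Fintype.card H : ℝ) ^ d := by
      have := Real.pow_arith_mean_le_arith_mean_pow Finset.univ
        (fun _ : Fin d → H => ((Fintype.card H : ℝ) ^ d)⁻¹) (fun s => |μ s ⟨1, by omega⟩|)
        (fun _ _ => by positivity) (by simp [hH.ne']) (fun _ _ => abs_nonneg _) (2 * k)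
      rwa [← Finset.mul_sum, ← Finset.mul_sum, inv_mul_eq_div, inv_mul_eq_div] at this
    refine Real.le_sqrt_of_sq_le ?_
    refine le_of_pow_le_pow_left₀ (n := k) (by omega) (by positivity) ?_
    rw [← pow_mul]
    refine (hjensen.trans hmoment).trans ?_
    have hfac : (0 : ℝ) < k.factorial := by exact_mod_cast k.factorial_pos
    rw [div_pow, div_le_div_iff₀ (by positivity) (by positivity)]
    calc _ ≤ L ^ k * k.factorial * (d : ℝ) ^ k := by gcongr
      _ = _ := by ring
end

section
/- Let k ≥ 2, d ≥ 1, n = 2^k − 1, and let s₁,…,s_d be independent uniform random elements of GL_k(F₂). Let μ₂ be the second largest (in absolute value) eigenvalue of the normalized adjacency matrix of the degree-2d Schreier graph of s₁,…,s_d acting on the nonzero vectors of F₂^k. Define X_p(c,ℓ,d') recursively by: X_p(0,0,d') = 1; X_p(c,ℓ,d') = 0 if p > ℓ (and (c,ℓ) ≠ (0,0)); otherwise X_p(c,ℓ,d') = Σ_{i=c}^{⌊ℓ/p⌋} C(d',i)·(2^p/p!)^i·(ℓ!/(ℓ−pi)!)·X_{p+1}(0, ℓ−pi, d'−i). Set x₃(i)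 = X₃(1, 2m−2i, d−i) and x₄(i) = X₄(0, 2m−2i, d−i). Then for every positive integer m, E(|μ₂|) ≤ ( (1/(2d))^{2m} · n · [ Σ_{i=1}^{m} C(d,i)·((2m)!/(2m−2i)!)·( (2^i−1)·(x₃(i)+x₄(i))·(2/n) + (x₃(i)+x₄(i))·(1/n) + (2^i/(i+1)!)·( x₃(i)·(5/n) + x₄(i) ) ) + X₁(1,2m,d)·(1/n) + x₃(0)·(5/n) + x₄(0) ] − 1 )^{1/(2m)}. -/
open scoped BigOperators

/-- The recursively defined quantity `X_p(c, ℓ, d)` from the statement: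
`X_p(0,0,d) = 1`; `X_p(c,ℓ,d) = 0` if `p > ℓ` (and `(c,ℓ) ≠ (0,0)`); otherwise
`X_p(c,ℓ,d) = Σ_{i=c}^{⌊ℓ/p⌋} C(d,i)·(2^p/p!)^i·(ℓ!/(ℓ−p·i)!)·X_{p+1}(0, ℓ−p·i, d−i)`. -/
noncomputable def Xrec : ℕ → ℕ → ℕ → ℕ → ℝ
  | p, c, l, d =>
    if c = 0 ∧ l = 0 then 1
    else if h : p > l then 0
    else ∑ i ∈ Finset.Icc c (l / p),
      (d.choose i : ℝ) * ((2 : ℝ) ^ p / (Nat.factorial p : ℝ)) ^ i *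
        ((Nat.factorial l : ℝ) / (Nat.factorial (l - p * i) : ℝ)) *
        Xrec (p + 1) 0 (l - p * i) (d - i)
termination_by p c l d => l + 1 - p
decreasing_by
  have h1 : l - p * i ≤ l := Nat.sub_le _ _
  omega

section Linear

/-- Over `F₂`, two vectors outside a subspace are related by an invertible matrix fixing the
subspace pointwise. -/
theorem exists_gl_fixing {k : ℕ} (W : Submodule (ZMod 2) (Fin k → ZMod 2))
    {p q : Fin k → ZMod 2} (hp : p ∉ W) (hq : q ∉ W) :
    ∃ g : GL (Fin k) (ZMod 2),
      (∀ w ∈ W, (g : Matrix (Fin k) (Fin k) (ZMod 2)).mulVec w = w) ∧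
        (g : Matrix (Fin k) (Fin k) (ZMod 2)).mulVec p = q := by
  have key : ∀ a : ZMod 2, a ≠ 0 → a = 1 := by decide
  obtain ⟨φ, hφ, hφp, hφq⟩ : ∃ φ : (Fin k → ZMod 2) →ₗ[ZMod 2] ZMod 2,
      (∀ w ∈ W, φ w = 0) ∧ φ p = 1 ∧ φ q = 1 := by
    obtain ⟨a, ha, ha'⟩ := Submodule.exists_le_ker_of_notMem hp
    obtain ⟨b, hb, hb'⟩ := Submodule.exists_le_ker_of_notMem hq
    have haW : ∀ w ∈ W, a w = 0 := fun w hw => ha' hw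
    have hbW : ∀ w ∈ W, b w = 0 := fun w hw => hb' hw
    by_cases h1 : a q = 0
    · by_cases h2 : b p = 0
      · refine ⟨a + b, fun w hw => by simp [haW w hw, hbW w hw], ?_, ?_⟩
        · simp [h2, key _ ha]
        · simp [h1, key _ hb]
      · exact ⟨b, hbW, key _ h2, key _ hb⟩
    · exact ⟨a, haW, key _ ha, key _ h1⟩
  have two : (1 + 1 : ZMod 2) = 0 := by decide
  have dbl : ∀ v : Fin k → ZMod 2, v + v = 0 := fun v => by
    ext i; simpa using CharTwo.add_self_eq_zero (v i)
  let T : (Fin k → ZMod 2) →ₗ[ZMod 2] (Fin k → ZMod 2) := LinearMap.id + φ.smulRight (p + q)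
  have hT : ∀ v, T v = v + φ v • (p + q) := fun v => rfl
  have hTT : T ∘ₗ T = LinearMap.id := by
    ext1 v
    ext1
    simp only [LinearMap.comp_apply, hT, map_add, map_smul, hφp, hφq, two, smul_zero, add_zero,
      LinearMap.id_apply]
    rw [add_assoc, dbl, add_zero]
  have hmul : LinearMap.toMatrix' T * LinearMap.toMatrix' T = 1 := by
    rw [← LinearMap.toMatrix'_comp, hTT, LinearMap.toMatrix'_id]
  refine ⟨⟨LinearMap.toMatrix' T, LinearMap.toMatrix' T, hmul, hmul⟩, fun w hw => ?_, ?_⟩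
  · simp [LinearMap.toMatrix'_mulVec, hT, hφ w hw]
  · simp only [LinearMap.toMatrix'_mulVec, hT, hφp, one_smul]
    rw [← add_assoc, dbl, zero_add]

end Linear

theorem sum_sum_add_mul_le {G Ω : Type*} [Fintype G] [Fintype Ω] (h7 : 7 ≤ Fintype.card Ω)
    (F : Ω → Ω → ℝ) (hF : ∀ x, ∑ y, F x y ≤ 1) :
    ∑ x : Ω, ∑ y : Ω, (3 * (Fintype.card G / ((Fintype.card Ω : ℝ) * (Fintype.card Ω - 1))) +
      F x y * (Fintype.card G / Fintype.card Ω)) ≤ 5 * Fintype.card G := by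
  have hn : (7 : ℝ) ≤ Fintype.card Ω := by exact_mod_cast h7
  have hn1 : (0 : ℝ) < Fintype.card Ω - 1 := by linarith
  have hn0 : (0 : ℝ) < Fintype.card Ω := by linarith
  have hK : (0 : ℝ) ≤ Fintype.card G := by positivity
  have hs : ∑ x, ∑ y, F x y ≤ Fintype.card Ω := by
    refine (Finset.sum_le_sum fun x _ => hF x).trans (by simp)
  simp only [Finset.sum_add_distrib, ← Finset.sum_mul, Finset.sum_const, Finset.card_univ,
    nsmul_eq_mul]
  have h1 : (∑ x, ∑ y, F x y) * ((Fintype.card G : ℝ) / Fintype.card Ω) ≤ Fintype.card G := by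
    refine (mul_le_mul_of_nonneg_right hs (by positivity)).trans (le_of_eq ?_)
    field_simp
  have h2 : (Fintype.card Ω : ℝ) * (Fintype.card Ω *
      (3 * (Fintype.card G / ((Fintype.card Ω : ℝ) * (Fintype.card Ω - 1))))) ≤
      4 * Fintype.card G := by
    have : (Fintype.card Ω : ℝ) * (Fintype.card Ω *
      (3 * (Fintype.card G / ((Fintype.card Ω : ℝ) * (Fintype.card Ω - 1))))) =
        3 * Fintype.card Ω * Fintype.card G / (Fintype.card Ω - 1) := by field_simp
    rw [this, div_le_iff₀ hn1]
    nlinarith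
  linarith

section Action

/-- The number of fixed points of `g`, as a real number. -/
noncomputable def fixCount {G : Type*} (Ω : Type*) [Fintype Ω] [DecidableEq Ω] [SMul G Ω] (g : G) :
    ℝ :=
  ∑ x : Ω, if g • x = x then 1 else 0

variable {G Ω : Type*} [Group G] [Fintype Ω] [DecidableEq Ω] [MulAction G Ω]

/-- The bounds on the number of group elements with prescribed values at up to three points that
hold for `GL_k(F₂)` acting on nonzero vectors; `t x y` plays the role of `x + y`. -/
structure TransitivityBounds (G Ω : Type*) [Group G] [Fintype G] [Fintype Ω] [DecidableEq Ω]
    [MulAction G Ω] (t : Ω → Ω → Ω) : Prop where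
  three_le : 3 ≤ Fintype.card Ω
  eq_or_le : Fintype.card Ω = 3 ∨ 7 ≤ Fintype.card Ω
  third_ne : ∀ x y : Ω, x ≠ y → t x y ≠ x ∧ t x y ≠ y
  one : ∀ x y : Ω, (Fintype.card Ω : ℝ) * (∑ g : G, if g • x = y then 1 else 0) = Fintype.card G
  two : ∀ x x' y y' : Ω, x ≠ x' → (Fintype.card Ω : ℝ) * (Fintype.card Ω - 1) *
    (∑ g : G, if g • x = y ∧ g • x' = y' then 1 else 0) ≤ Fintype.card G
  three : ∀ x x' x'' y y' y'' : Ω, x ≠ x' → x'' ≠ x → x'' ≠ x' → x'' ≠ t x x' →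
    (Fintype.card Ω : ℝ) * (Fintype.card Ω - 1) * (Fintype.card Ω - 3) *
    (∑ g : G, if g • x = y ∧ g • x' = y' ∧ g • x'' = y'' then 1 else 0) ≤ Fintype.card G

/-- If the pointwise stabilizer data `P` is invariant under right translations that move any point
of `Z` to any other, then requiring one more value costs a factor `|Z|`. -/
theorem card_mul_sum_le [Fintype G] (P : G → Prop) [DecidablePred P] (Z : Finset Ω) (y z : Ω)
    (h : ∀ p ∈ Z, ∃ a : G, a • z = p ∧ ∀ g, P (g * a) ↔ P g) :
    (Z.card : ℝ) * (∑ g : G, if P g ∧ g • z = y then (1 : ℝ) else 0) ≤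
      ∑ g : G, if P g then 1 else 0 := by
  have h1 : ∀ p ∈ Z, (∑ g : G, if P g ∧ g • p = y then (1 : ℝ) else 0) =
      ∑ g : G, if P g ∧ g • z = y then (1 : ℝ) else 0 := by
    intro p hp
    obtain ⟨a, ha, hP⟩ := h p hp
    refine Fintype.sum_equiv (Equiv.mulRight a) _ _ fun g => ?_
    simp only [Equiv.coe_mulRight, hP, mul_smul, ha]
  rw [← nsmul_eq_mul, ← Finset.sum_const, ← Finset.sum_congr rfl h1, Finset.sum_comm]
  refine Finset.sum_le_sum fun g _ => ?_
  by_cases hg : P g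
  · simp only [hg, true_and, if_true]
    calc (∑ p ∈ Z, if g • p = y then (1 : ℝ) else 0)
        ≤ ∑ p : Ω, if g • p = y then (1 : ℝ) else 0 :=
          Finset.sum_le_univ_sum_of_nonneg fun p => by split_ifs <;> norm_num
      _ = 1 := by simp [smul_eq_iff_eq_inv_smul]
  · simp [hg]

theorem ite_one_zero_and (p q : Prop) [Decidable p] [Decidable q] :
    (if p ∧ q then (1 : ℝ) else 0) = (if p then 1 else 0) * (if q then 1 else 0) := by
  by_cases hp : p <;> by_cases hq : q <;> simp [hp, hq]

theorem fixCount_le (g : G) : fixCount Ω g ≤ Fintype.card Ω := by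
  calc fixCount Ω g ≤ ∑ _x : Ω, (1 : ℝ) :=
        Finset.sum_le_sum fun x _ => by split_ifs <;> norm_num
    _ = Fintype.card Ω := by simp

theorem fixCount_mul_comm (g h : G) : fixCount Ω (g * h) = fixCount Ω (h * g) := by
  refine Fintype.sum_equiv (MulAction.toPerm h) _ _ fun x => ?_
  simp only [MulAction.toPerm_apply, mul_smul, smul_left_cancel_iff]

theorem sum_ite_smul_eq_smul (a b : G) :
    (∑ x : Ω, ∑ y : Ω, if a • x = b • y then (1 : ℝ) else 0) = Fintype.card Ω := by
  have : ∀ x : Ω, (∑ y : Ω, if a • x = b • y then (1 : ℝ) else 0) = 1 := fun x => by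
    have : ∀ y : Ω, a • x = b • y ↔ b⁻¹ • a • x = y := fun y => by
      rw [inv_smul_eq_iff]
    simp [this]
  simp [this]

namespace TransitivityBounds

variable [Fintype G] {t : Ω → Ω → Ω} (H : TransitivityBounds G Ω t)
include H

theorem card_pos : (3 : ℝ) ≤ Fintype.card Ω := by exact_mod_cast H.three_le

/-- Upper bound for the number of group elements with two prescribed values. -/
theorem two_point (x x' y y' : Ω) :
    (∑ g : G, if g • x = y ∧ g • x' = y' then (1 : ℝ) else 0) ≤
      Fintype.card G * ((if x = x' then 1 else 0) * (if y = y' then 1 else 0) *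
          (1 / (Fintype.card Ω - 1 : ℝ)) +
        (1 - (if x = x' then 1 else 0) - (if y = y' then 1 else 0)) *
          (1 / ((Fintype.card Ω : ℝ) * (Fintype.card Ω - 1)))) := by
  have hn := H.card_pos
  have hn1 : (0 : ℝ) < Fintype.card Ω - 1 := by linarith
  have hn0 : (0 : ℝ) < Fintype.card Ω := by linarith
  by_cases hx : x = x' <;> by_cases hy : y = y'
  · subst hx; subst hy
    have := H.one x y
    simp only [and_self, if_true]
    have h2 : (∑ g : G, if g • x = y then (1 : ℝ) else 0) = Fintype.card G / Fintype.card Ω := by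
      rw [← this]; field_simp
    rw [h2]
    apply le_of_eq
    field_simp
    ring
  · subst hx
    have : ∀ g : G, ¬ (g • x = y ∧ g • x = y') := fun g h => hy (h.1.symm.trans h.2)
    simp [this, hy]
  · subst hy
    have : ∀ g : G, ¬ (g • x = y ∧ g • x' = y) := fun g h =>
      hx (smul_left_cancel g (h.1.trans h.2.symm))
    simp [this, hx]
  · have := H.two x x' y y' hx
    simp only [hx, hy, if_false]
    rw [mul_comm, ← le_div_iff₀ (by positivity)] at this
    refine this.trans (le_of_eq ?_)
    field_simp
    ring

/-- A group element occurring once makes the expected number of fixed points equal to one. -/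
theorem sum_fixCount_one (u v : G) : ∑ g : G, fixCount Ω (u * g * v) = Fintype.card G := by
  have hn0 : (0 : ℝ) < Fintype.card Ω := by linarith [H.card_pos]
  unfold fixCount
  rw [Finset.sum_comm]
  have : ∀ x : Ω, (∑ g : G, if (u * g * v) • x = x then (1 : ℝ) else 0) =
      Fintype.card G / Fintype.card Ω := fun x => by
    rw [← H.one (v • x) (u⁻¹ • x)]
    simp only [mul_smul, eq_inv_smul_iff]
    field_simp
  simp only [this, Finset.sum_const, Finset.card_univ, nsmul_eq_mul]
  field_simp

theorem sum_fixCount_same (u v : G) :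
    ∑ g : G, fixCount Ω (g * u * g * v) ≤
      Fintype.card G * (1 + (fixCount Ω (u⁻¹ * v) - 1) / (Fintype.card Ω - 1)) := by
  have hn := H.card_pos
  have hn1 : (0 : ℝ) < Fintype.card Ω - 1 := by linarith
  have hn0 : (0 : ℝ) < Fintype.card Ω := by linarith
  have e1 : ∑ g : G, fixCount Ω (g * u * g * v) =
      ∑ x : Ω, ∑ y : Ω, ∑ g : G, if g • (v • x) = y ∧ g • (u • y) = x then (1 : ℝ) else 0 := by
    unfold fixCount
    rw [Finset.sum_comm]
    refine Finset.sum_congr rfl fun x _ => ?_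
    rw [Finset.sum_comm]
    refine Finset.sum_congr rfl fun g _ => ?_
    simp [ite_and, mul_smul]
  have e2 : (∑ x : Ω, ∑ y : Ω, (if v • x = u • y then (1 : ℝ) else 0) * (if y = x then 1 else 0)) =
      fixCount Ω (u⁻¹ * v) := by
    unfold fixCount
    refine Finset.sum_congr rfl fun x _ => ?_
    simp [mul_smul, inv_smul_eq_iff]
  have e3 : (∑ x : Ω, ∑ y : Ω, if y = x then (1 : ℝ) else 0) = Fintype.card Ω := by simp
  rw [e1]
  refine (Finset.sum_le_sum fun x _ => Finset.sum_le_sum fun y _ => H.two_point _ _ _ _).trans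
    (le_of_eq ?_)
  simp only [← Finset.mul_sum, Finset.sum_add_distrib, ← Finset.sum_mul, Finset.sum_sub_distrib,
    e2, e3, sum_ite_smul_eq_smul]
  simp only [Finset.sum_const, Finset.card_univ, nsmul_eq_mul, mul_one]
  field_simp
  ring

theorem sum_fixCount_opp (u v : G) :
    ∑ g : G, fixCount Ω (g * u * g⁻¹ * v) ≤
      Fintype.card G * (1 + (fixCount Ω u - 1) * (fixCount Ω v - 1) / (Fintype.card Ω - 1)) := by
  have hn := H.card_pos
  have hn1 : (0 : ℝ) < Fintype.card Ω - 1 := by linarith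
  have hn0 : (0 : ℝ) < Fintype.card Ω := by linarith
  have e1 : ∑ g : G, fixCount Ω (g * u * g⁻¹ * v) =
      ∑ x : Ω, ∑ y : Ω, ∑ g : G, if g • y = v • x ∧ g • (u • y) = x then (1 : ℝ) else 0 := by
    unfold fixCount
    rw [Finset.sum_comm]
    refine Finset.sum_congr rfl fun x _ => ?_
    rw [Finset.sum_comm]
    refine Finset.sum_congr rfl fun g _ => ?_
    simp [ite_and, mul_smul, smul_eq_iff_eq_inv_smul g]
  have e2 : (∑ y : Ω, (if y = u • y then (1 : ℝ) else 0)) = fixCount Ω u := by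
    simp [fixCount, eq_comm]
  have e2' : (∑ x : Ω, (if v • x = x then (1 : ℝ) else 0)) = fixCount Ω v := rfl
  have e4 : (∑ x : Ω, ∑ y : Ω, if v • x = x then (1 : ℝ) else 0) =
      Fintype.card Ω * fixCount Ω v := by
    rw [Finset.sum_comm]
    simp [fixCount]
  rw [e1]
  refine (Finset.sum_le_sum fun x _ => Finset.sum_le_sum fun y _ => H.two_point _ _ _ _).trans
    (le_of_eq ?_)
  simp only [← Finset.mul_sum, Finset.sum_add_distrib, ← Finset.sum_mul, Finset.sum_sub_distrib,
    e2, e2', e4]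
  simp only [Finset.sum_const, Finset.card_univ, nsmul_eq_mul, mul_one]
  field_simp
  ring

theorem sum_fixCount_same_le (u v : G) :
    ∑ g : G, fixCount Ω (g * u * g * v) ≤ 2 * Fintype.card G := by
  have hn := H.card_pos
  refine (H.sum_fixCount_same u v).trans ?_
  have := fixCount_le (Ω := Ω) (u⁻¹ * v)
  have h1 : (fixCount Ω (u⁻¹ * v) - 1) / (Fintype.card Ω - 1) ≤ 1 := by
    rw [div_le_one (by linarith)]; linarith
  have h2 : (0 : ℝ) ≤ Fintype.card G := by positivity
  nlinarith

theorem sum_fixCount_mul_fixCount_inv (u v w z : G) :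
    ∑ h : G, fixCount Ω (u * h * v) * fixCount Ω (w * h⁻¹ * z) ≤ 2 * Fintype.card G := by
  have hn := H.card_pos
  have hn1 : (0 : ℝ) < Fintype.card Ω - 1 := by linarith
  have hn0 : (0 : ℝ) < Fintype.card Ω := by linarith
  have e1 : ∑ h : G, fixCount Ω (u * h * v) * fixCount Ω (w * h⁻¹ * z) =
      ∑ x : Ω, ∑ y : Ω, ∑ h : G,
        if h • (v • x) = u⁻¹ • x ∧ h • (w⁻¹ • y) = z • y then (1 : ℝ) else 0 := by
    unfold fixCount
    simp only [Finset.sum_mul_sum]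
    rw [Finset.sum_comm]
    refine Finset.sum_congr rfl fun x _ => ?_
    rw [Finset.sum_comm]
    refine Finset.sum_congr rfl fun y _ => Finset.sum_congr rfl fun h _ => ?_
    rw [ite_one_zero_and]
    congr 2
    · simp only [mul_smul, eq_inv_smul_iff]
    · simp only [mul_smul, smul_eq_iff_eq_inv_smul w, smul_eq_iff_eq_inv_smul h]
      exact propext eq_comm
  have e2 : (∑ x : Ω, ∑ y : Ω, (if v • x = w⁻¹ • y then (1 : ℝ) else 0) *
      (if u⁻¹ • x = z • y then 1 else 0)) ≤ Fintype.card Ω := by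
    rw [← sum_ite_smul_eq_smul v w⁻¹]
    refine Finset.sum_le_sum fun x _ => Finset.sum_le_sum fun y _ => ?_
    split_ifs <;> norm_num
  rw [e1]
  refine (Finset.sum_le_sum fun x _ => Finset.sum_le_sum fun y _ => H.two_point _ _ _ _).trans ?_
  simp only [← Finset.mul_sum, Finset.sum_add_distrib, ← Finset.sum_mul, Finset.sum_sub_distrib,
    sum_ite_smul_eq_smul]
  simp only [Finset.sum_const, Finset.card_univ, nsmul_eq_mul, mul_one]
  rw [mul_comm (2 : ℝ)]
  refine mul_le_mul_of_nonneg_left ?_ (by positivity)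
  refine (add_le_add_left (mul_le_mul_of_nonneg_right e2 (by positivity)) _).trans (le_of_eq ?_)
  field_simp
  ring

/-- Two interleaved generators, each occurring once together with its inverse. -/
theorem sum_fixCount_opp_opp (a b c e f : G) :
    ∑ h : G, ∑ g : G, fixCount Ω (a * g * b * h * c * g⁻¹ * e * h⁻¹ * f) ≤
      (1 + 1 / (Fintype.card Ω - 1)) * (Fintype.card G : ℝ) ^ 2 := by
  have hn := H.card_pos
  have hn1 : (0 : ℝ) < Fintype.card Ω - 1 := by linarith
  have hK : (0 : ℝ) ≤ Fintype.card G := by positivity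
  have h1 : ∀ h : G, ∑ g : G, fixCount Ω (a * g * b * h * c * g⁻¹ * e * h⁻¹ * f) ≤
      Fintype.card G * (1 + (fixCount Ω (b * h * c) * fixCount Ω (e * h⁻¹ * (f * a))
        - fixCount Ω (b * h * c) - fixCount Ω (e * h⁻¹ * (f * a)) + 1)
          / (Fintype.card Ω - 1)) := fun h => by
    convert H.sum_fixCount_opp (b * h * c) (e * h⁻¹ * (f * a)) using 2 with g
    · rw [mul_assoc a, mul_assoc a, mul_assoc a, mul_assoc a, mul_assoc a, mul_assoc a,
        mul_assoc a, fixCount_mul_comm]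
      simp only [mul_assoc]
    · ring
  have h2 : ∑ h : G, fixCount Ω (e * h⁻¹ * (f * a)) = Fintype.card G := by
    rw [← H.sum_fixCount_one e (f * a)]
    exact Fintype.sum_equiv (Equiv.inv G) _ _ fun h => rfl
  have h3 := H.sum_fixCount_mul_fixCount_inv b c e (f * a)
  refine (Finset.sum_le_sum fun h _ => h1 h).trans ?_
  rw [← Finset.mul_sum, Finset.sum_add_distrib, ← Finset.sum_div, Finset.sum_add_distrib,
    Finset.sum_sub_distrib, Finset.sum_sub_distrib, h2, H.sum_fixCount_one]
  simp only [Finset.sum_const, Finset.card_univ, nsmul_eq_mul, mul_one]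
  have h4 : ((∑ h : G, fixCount Ω (b * h * c) * fixCount Ω (e * h⁻¹ * (f * a)))
      - Fintype.card G - Fintype.card G + Fintype.card G) / (Fintype.card Ω - 1 : ℝ) ≤
      Fintype.card G / (Fintype.card Ω - 1) := by
    gcongr; linarith
  calc _ ≤ (Fintype.card G : ℝ) * (Fintype.card G + Fintype.card G / (Fintype.card Ω - 1)) := by
        gcongr
    _ = _ := by ring

/-- Two interleaved generators, the first one occurring twice with the same sign, the second one
occurring once together with its inverse. -/
theorem sum_fixCount_same_opp (a b c e f : G) :
    ∑ h : G, ∑ g : G, fixCount Ω (a * g * b * h * c * g * e * h⁻¹ * f) ≤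
      (1 + 1 / (Fintype.card Ω - 1)) * (Fintype.card G : ℝ) ^ 2 := by
  have hn := H.card_pos
  have hn1 : (0 : ℝ) < Fintype.card Ω - 1 := by linarith
  have hK : (0 : ℝ) ≤ Fintype.card G := by positivity
  have h1 : ∀ h : G, ∑ g : G, fixCount Ω (a * g * b * h * c * g * e * h⁻¹ * f) ≤
      Fintype.card G * (1 + (fixCount Ω (h⁻¹ * (b⁻¹ * e) * h⁻¹ * (f * a * c⁻¹)) - 1)
          / (Fintype.card Ω - 1)) := fun h => by
    convert H.sum_fixCount_same (b * h * c) (e * h⁻¹ * (f * a)) using 2 with g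
    · rw [mul_assoc a, mul_assoc a, mul_assoc a, mul_assoc a, mul_assoc a, mul_assoc a,
        mul_assoc a, fixCount_mul_comm]
      simp only [mul_assoc]
    · congr 3
      rw [← mul_assoc _ (f * a) c⁻¹, fixCount_mul_comm]
      simp only [mul_assoc, mul_inv_rev]
  have h3 : ∑ h : G, fixCount Ω (h⁻¹ * (b⁻¹ * e) * h⁻¹ * (f * a * c⁻¹)) ≤ 2 * Fintype.card G := by
    refine le_trans (le_of_eq ?_) (H.sum_fixCount_same_le (b⁻¹ * e) (f * a * c⁻¹))
    exact Fintype.sum_equiv (Equiv.inv G) _ _ fun h => rfl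
  refine (Finset.sum_le_sum fun h _ => h1 h).trans ?_
  rw [← Finset.mul_sum, Finset.sum_add_distrib, ← Finset.sum_div, Finset.sum_sub_distrib]
  simp only [Finset.sum_const, Finset.card_univ, nsmul_eq_mul, mul_one]
  have h4 : ((∑ h : G, fixCount Ω (h⁻¹ * (b⁻¹ * e) * h⁻¹ * (f * a * c⁻¹)))
      - Fintype.card G) / (Fintype.card Ω - 1 : ℝ) ≤
      Fintype.card G / (Fintype.card Ω - 1) := by
    gcongr; linarith
  calc _ ≤ (Fintype.card G : ℝ) * (Fintype.card G + Fintype.card G / (Fintype.card Ω - 1)) := by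
        gcongr
    _ = _ := by ring

theorem two_le (x x' y y' : Ω) (hx : x ≠ x') :
    (∑ g : G, if g • x = y ∧ g • x' = y' then (1 : ℝ) else 0) ≤
      Fintype.card G / ((Fintype.card Ω : ℝ) * (Fintype.card Ω - 1)) := by
  have hn := H.card_pos
  have hn1 : (0 : ℝ) < Fintype.card Ω - 1 := by linarith
  have hn0 : (0 : ℝ) < Fintype.card Ω := by linarith
  rw [le_div_iff₀ (by positivity), mul_comm]
  exact H.two x x' y y' hx

/-- The number of `g` with two prescribed values, one of them for `g u g`. -/
theorem sum_smul_smul_le (h7 : 7 ≤ Fintype.card Ω) (u : G) (p p' q x : Ω) :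
    (∑ g : G, if g • p = q ∧ g • u • g • p' = x then (1 : ℝ) else 0) ≤
      3 * (Fintype.card G / ((Fintype.card Ω : ℝ) * (Fintype.card Ω - 1))) +
        (if x = q ∧ u • q = p then 1 else 0) * (Fintype.card G / Fintype.card Ω) := by
  have hn : (7 : ℝ) ≤ Fintype.card Ω := by exact_mod_cast h7
  have hn1 : (0 : ℝ) < Fintype.card Ω - 1 := by linarith
  have hn3 : (0 : ℝ) < Fintype.card Ω - 3 := by linarith
  have hn0 : (0 : ℝ) < Fintype.card Ω := by linarith
  have hK : (0 : ℝ) ≤ Fintype.card G := by positivity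
  set c : ℝ := Fintype.card G / ((Fintype.card Ω : ℝ) * (Fintype.card Ω - 1)) with hc
  have hc0 : 0 ≤ c := by positivity
  have hK' : (0 : ℝ) ≤ Fintype.card G / Fintype.card Ω := by positivity
  have hex : 0 ≤ (if x = q ∧ u • q = p then (1 : ℝ) else 0) *
      (Fintype.card G / Fintype.card Ω) := by
    split_ifs <;> simp [hK']
  by_cases hp : p = p'
  · subst hp
    have e1 : ∀ g : G, (g • p = q ∧ g • u • g • p = x) ↔ (g • p = q ∧ g • u • q = x) := fun g =>
      ⟨fun h => ⟨h.1, h.1 ▸ h.2⟩, fun h => ⟨h.1, by rw [h.1]; exact h.2⟩⟩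
    simp only [e1]
    by_cases hu : u • q = p
    · by_cases hx : x = q
      · have h1 : (∑ g : G, if g • p = q then (1 : ℝ) else 0) =
            Fintype.card G / Fintype.card Ω := by
          rw [← H.one p q]; field_simp
        subst hx
        simp only [hu, and_self, if_true, h1]
        linarith
      · have : ∀ g : G, ¬ (g • p = q ∧ g • u • q = x) := fun g h => by
          rw [hu] at h; exact hx (h.2.symm.trans h.1)
        simp only [this, if_false, Finset.sum_const_zero]
        linarith
    · have := H.two_le p (u • q) q x (Ne.symm hu)
      linarith
  · have main : ∀ g : G, (if g • p = q ∧ g • u • g • p' = x then (1 : ℝ) else 0) ≤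
        (if x = q then 1 else 0) * (if g • p = q ∧ g • p' = u⁻¹ • p then 1 else 0) +
        (if x = q then 0 else 1) * (if g • p = q ∧ g • p' = u⁻¹ • p' then 1 else 0) +
        (if g • p = q ∧ g • p' = u⁻¹ • t p p' then 1 else 0) +
        ∑ z ∈ Finset.univ.filter (fun z : Ω => u • z ≠ p ∧ u • z ≠ p' ∧ u • z ≠ t p p'),
          (if g • p = q ∧ g • p' = z ∧ g • (u • z) = x then 1 else 0) := by
      intro g
      have hs : 0 ≤ ∑ z ∈ Finset.univ.filter
          (fun z : Ω => u • z ≠ p ∧ u • z ≠ p' ∧ u • z ≠ t p p'),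
          (if g • p = q ∧ g • p' = z ∧ g • (u • z) = x then (1 : ℝ) else 0) :=
        Finset.sum_nonneg fun z _ => by split_ifs <;> norm_num
      by_cases hg : g • p = q ∧ g • u • g • p' = x
      · rw [if_pos hg]
        obtain ⟨h1, h2⟩ := hg
        have n2 : 0 ≤ (if x = q then (0 : ℝ) else 1) *
            (if g • p = q ∧ g • p' = u⁻¹ • p' then 1 else 0) := by
          split_ifs <;> norm_num
        have n1 : 0 ≤ (if x = q then (1 : ℝ) else 0) *
            (if g • p = q ∧ g • p' = u⁻¹ • p then 1 else 0) := by
          split_ifs <;> norm_num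
        have n3 : 0 ≤ (if g • p = q ∧ g • p' = u⁻¹ • t p p' then (1 : ℝ) else 0) := by
          split_ifs <;> norm_num
        by_cases c1 : u • g • p' = p
        · have hx : x = q := by rw [← h2, c1, h1]
          have : (if x = q then (1 : ℝ) else 0) *
            (if g • p = q ∧ g • p' = u⁻¹ • p then 1 else 0) = 1 := by
            rw [if_pos hx, if_pos ⟨h1, by rw [eq_inv_smul_iff, c1]⟩, one_mul]
          linarith
        by_cases c2 : u • g • p' = p'
        · have hx : x ≠ q := fun e => by
            rw [c2] at h2
            exact hp (smul_left_cancel g (h1.trans (e.symm.trans h2.symm)))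
          have : (if x = q then (0 : ℝ) else 1) *
            (if g • p = q ∧ g • p' = u⁻¹ • p' then 1 else 0) = 1 := by
            rw [if_neg hx, if_pos ⟨h1, by rw [eq_inv_smul_iff, c2]⟩, one_mul]
          linarith
        by_cases c3 : u • g • p' = t p p'
        · have : (if g • p = q ∧ g • p' = u⁻¹ • t p p' then (1 : ℝ) else 0) = 1 := by
            rw [if_pos ⟨h1, by rw [eq_inv_smul_iff, c3]⟩]
          linarith
        · have : 1 ≤ ∑ z ∈ Finset.univ.filter
              (fun z : Ω => u • z ≠ p ∧ u • z ≠ p' ∧ u • z ≠ t p p'),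
              (if g • p = q ∧ g • p' = z ∧ g • (u • z) = x then (1 : ℝ) else 0) := by
            refine le_trans ?_ (Finset.single_le_sum (a := g • p')
              (fun z _ => by split_ifs <;> norm_num) (by simp [c1, c2, c3]))
            rw [if_pos ⟨h1, rfl, h2⟩]
          linarith
      · rw [if_neg hg]
        have n2 : 0 ≤ (if x = q then (0 : ℝ) else 1) *
            (if g • p = q ∧ g • p' = u⁻¹ • p' then 1 else 0) := by
          split_ifs <;> norm_num
        have n1 : 0 ≤ (if x = q then (1 : ℝ) else 0) *
            (if g • p = q ∧ g • p' = u⁻¹ • p then 1 else 0) := by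
          split_ifs <;> norm_num
        have n3 : 0 ≤ (if g • p = q ∧ g • p' = u⁻¹ • t p p' then (1 : ℝ) else 0) := by
          split_ifs <;> norm_num
        linarith
    refine (Finset.sum_le_sum fun g _ => main g).trans ?_
    simp only [Finset.sum_add_distrib, ← Finset.mul_sum]
    have b1 := H.two_le p p' q (u⁻¹ • p) hp
    have b2 := H.two_le p p' q (u⁻¹ • p') hp
    have b3 := H.two_le p p' q (u⁻¹ • t p p') hp
    have b12 : (if x = q then (1 : ℝ) else 0) *
          (∑ g : G, if g • p = q ∧ g • p' = u⁻¹ • p then 1 else 0) +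
        (if x = q then 0 else 1) *
          (∑ g : G, if g • p = q ∧ g • p' = u⁻¹ • p' then 1 else 0) ≤ c := by
      split_ifs
      · simpa using b1
      · simpa using b2
    have b4 : (∑ g : G, ∑ z ∈ Finset.univ.filter
        (fun z : Ω => u • z ≠ p ∧ u • z ≠ p' ∧ u • z ≠ t p p'),
          (if g • p = q ∧ g • p' = z ∧ g • (u • z) = x then (1 : ℝ) else 0)) ≤ c := by
      obtain ⟨t1, t2⟩ := H.third_ne p p' hp
      have hcard : ((Finset.univ.filter
          (fun z : Ω => u • z ≠ p ∧ u • z ≠ p' ∧ u • z ≠ t p p')).card : ℝ) =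
          Fintype.card Ω - 3 := by
        have e : Finset.univ.filter (fun z : Ω => u • z ≠ p ∧ u • z ≠ p' ∧ u • z ≠ t p p') =
            ({u⁻¹ • p, u⁻¹ • p', u⁻¹ • t p p'} : Finset Ω)ᶜ := by
          ext z
          simp [eq_inv_smul_iff]
        have e3 : ({u⁻¹ • p, u⁻¹ • p', u⁻¹ • t p p'} : Finset Ω).card = 3 := by
          rw [Finset.card_eq_three]
          exact ⟨_, _, _, by simpa using hp, by simpa using t1.symm, by simpa using t2.symm, rfl⟩
        rw [e, Finset.card_compl, e3, Nat.cast_sub (by omega)]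
        norm_num
      rw [Finset.sum_comm]
      have hz : ∀ z ∈ Finset.univ.filter
          (fun z : Ω => u • z ≠ p ∧ u • z ≠ p' ∧ u • z ≠ t p p'),
          (∑ g : G, if g • p = q ∧ g • p' = z ∧ g • (u • z) = x then (1 : ℝ) else 0) ≤
            c / (Fintype.card Ω - 3) := by
        intro z hz
        simp only [Finset.mem_filter, Finset.mem_univ, true_and] at hz
        have := H.three p p' (u • z) q z x hp hz.1 hz.2.1 hz.2.2
        rw [mul_comm, ← le_div_iff₀ (by positivity)] at this
        rwa [hc, div_div]
      refine (Finset.sum_le_sum hz).trans (le_of_eq ?_)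
      rw [Finset.sum_const, nsmul_eq_mul, hcard]
      field_simp
    linarith

theorem sum_fixCount_plus (h7 : 7 ≤ Fintype.card Ω) (u v w : G) :
    ∑ g : G, fixCount Ω (g * u * g * v * g * w) ≤ 5 * Fintype.card G := by
  have e1 : ∑ g : G, fixCount Ω (g * u * g * v * g * w) = ∑ x : Ω, ∑ y : Ω, ∑ g : G,
      if g • (w • x) = y ∧ g • u • g • (v • y) = x then (1 : ℝ) else 0 := by
    unfold fixCount
    rw [Finset.sum_comm]
    refine Finset.sum_congr rfl fun x _ => ?_
    rw [Finset.sum_comm]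
    refine Finset.sum_congr rfl fun g _ => ?_
    simp [ite_and, mul_smul]
  rw [e1]
  refine (Finset.sum_le_sum fun x _ => Finset.sum_le_sum fun y _ =>
    H.sum_smul_smul_le h7 _ _ _ _ _).trans (sum_sum_add_mul_le h7 _ fun x => ?_)
  refine (Finset.sum_le_sum fun y _ => (?_ : _ ≤ if x = y then (1 : ℝ) else 0)).trans (by simp)
  by_cases h : x = y
  · simp only [h, true_and, if_true]; split_ifs <;> norm_num
  · simp [h]

theorem sum_fixCount_minus (h7 : 7 ≤ Fintype.card Ω) (u v w : G) :
    ∑ g : G, fixCount Ω (g * u * g * v * g⁻¹ * w) ≤ 5 * Fintype.card G := by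
  have e1 : ∑ g : G, fixCount Ω (g * u * g * v * g⁻¹ * w) = ∑ x : Ω, ∑ y : Ω, ∑ g : G,
      if g • y = w • x ∧ g • u • g • (v • y) = x then (1 : ℝ) else 0 := by
    unfold fixCount
    rw [Finset.sum_comm]
    refine Finset.sum_congr rfl fun x _ => ?_
    rw [Finset.sum_comm]
    refine Finset.sum_congr rfl fun g _ => ?_
    have : ∀ y : Ω, (g • y = w • x ∧ g • u • g • (v • y) = x) ↔
        (y = g⁻¹ • w • x ∧ g • u • g • (v • y) = x) := fun y => by rw [eq_inv_smul_iff]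
    simp [this, ite_and, mul_smul]
  rw [e1]
  refine (Finset.sum_le_sum fun x _ => Finset.sum_le_sum fun y _ =>
    H.sum_smul_smul_le h7 _ _ _ _ _).trans (sum_sum_add_mul_le h7 _ fun x => ?_)
  refine (Finset.sum_le_sum fun y _ =>
    (?_ : _ ≤ if u • w • x = y then (1 : ℝ) else 0)).trans (by simp)
  by_cases h : u • w • x = y
  · simp only [h, and_true, if_true]; split_ifs <;> norm_num
  · simp [h]

/-- A generator occurring three times. -/
theorem sum_fixCount_three (a b c e : G) (η θ : Bool) :
    ∑ g : G, fixCount Ω (a * g * b * (if η then g else g⁻¹) * c * (if θ then g else g⁻¹) * e) ≤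
      5 * Fintype.card G := by
  have hK : (0 : ℝ) ≤ Fintype.card G := by positivity
  rcases H.eq_or_le with h3 | h7
  · calc _ ≤ ∑ g : G, (3 : ℝ) := Finset.sum_le_sum fun g _ => by
          have := fixCount_le (Ω := Ω)
            (a * g * b * (if η then g else g⁻¹) * c * (if θ then g else g⁻¹) * e)
          rw [h3] at this
          exact_mod_cast this
      _ ≤ _ := by
          simp only [Finset.sum_const, Finset.card_univ, nsmul_eq_mul]
          linarith
  cases η <;> cases θ <;> simp only [Bool.false_eq_true, if_false, if_true]
  · refine le_trans (le_of_eq ?_) (H.sum_fixCount_minus h7 c (e * a) b)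
    refine Fintype.sum_equiv (Equiv.inv G) _ _ fun g => ?_
    rw [show a * g * b * g⁻¹ * c * g⁻¹ * e = (a * g * b) * (g⁻¹ * c * g⁻¹ * e) by group,
      fixCount_mul_comm]
    simp only [Equiv.inv_apply, inv_inv, mul_assoc]
  · refine le_trans (le_of_eq ?_) (H.sum_fixCount_minus h7 (e * a) b c)
    refine Finset.sum_congr rfl fun g _ => ?_
    rw [show a * g * b * g⁻¹ * c * g * e = (a * g * b * g⁻¹ * c) * (g * e) by group,
      fixCount_mul_comm]
    simp only [mul_assoc]
  · refine le_trans (le_of_eq ?_) (H.sum_fixCount_minus h7 b c (e * a))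
    refine Finset.sum_congr rfl fun g _ => ?_
    rw [show a * g * b * g * c * g⁻¹ * e = a * (g * b * g * c * g⁻¹ * e) by group,
      fixCount_mul_comm]
    simp only [mul_assoc]
  · refine le_trans (le_of_eq ?_) (H.sum_fixCount_plus h7 b c (e * a))
    refine Finset.sum_congr rfl fun g _ => ?_
    rw [show a * g * b * g * c * g * e = a * (g * b * g * c * g * e) by group,
      fixCount_mul_comm]
    simp only [mul_assoc]

end TransitivityBounds

end Action

section GeneralLinear

/-- `GL_k(F₂)` acts on nonzero vectors. -/
instance glMulAction (k : ℕ) : MulAction (GL (Fin k) (ZMod 2)) {v : Fin k → ZMod 2 // v ≠ 0} where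
  smul g x := ⟨(g : Matrix (Fin k) (Fin k) (ZMod 2)).mulVec x.1, fun h => x.2 (by
    have : ((g⁻¹ : GL (Fin k) (ZMod 2)) : Matrix (Fin k) (Fin k) (ZMod 2)).mulVec
        ((g : Matrix (Fin k) (Fin k) (ZMod 2)).mulVec x.1) = 0 := by
      rw [h, Matrix.mulVec_zero]
    rwa [Matrix.mulVec_mulVec, ← Units.val_mul, inv_mul_cancel, Units.val_one,
      Matrix.one_mulVec] at this)⟩
  one_smul x := Subtype.ext (Matrix.one_mulVec _)
  mul_smul g h x := Subtype.ext (by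
    change (((g * h : GL (Fin k) (ZMod 2)) : Matrix (Fin k) (Fin k) (ZMod 2)).mulVec x.1) = _
    rw [Units.val_mul, ← Matrix.mulVec_mulVec]
    rfl)

theorem gl_smul_val {k : ℕ} (g : GL (Fin k) (ZMod 2)) (x : {v : Fin k → ZMod 2 // v ≠ 0}) :
    (g • x).1 = (g : Matrix (Fin k) (Fin k) (ZMod 2)).mulVec x.1 := rfl

/-- The sum of two nonzero vectors, with a junk value when they are equal. -/
def thirdPoint {k : ℕ} (x y : {v : Fin k → ZMod 2 // v ≠ 0}) : {v : Fin k → ZMod 2 // v ≠ 0} :=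
  if h : x.1 + y.1 ≠ 0 then ⟨x.1 + y.1, h⟩ else x

theorem add_eq_zero_iff_eq_zmod_two {k : ℕ} (x y : Fin k → ZMod 2) : x + y = 0 ↔ x = y := by
  constructor
  · intro h
    ext i
    exact CharTwo.add_eq_zero.1 (congrFun h i)
  · rintro rfl
    ext i
    exact CharTwo.add_self_eq_zero (x i)

theorem thirdPoint_val {k : ℕ} {x y : {v : Fin k → ZMod 2 // v ≠ 0}} (h : x ≠ y) :
    (thirdPoint x y).1 = x.1 + y.1 := by
  have : x.1 + y.1 ≠ 0 := fun e => h (Subtype.ext ((add_eq_zero_iff_eq_zmod_two _ _).1 e))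
  simp [thirdPoint, this]

theorem card_nonzero (k : ℕ) : Fintype.card {v : Fin k → ZMod 2 // v ≠ 0} = 2 ^ k - 1 := by
  rw [Fintype.card_subtype_compl]
  simp

theorem gl_exists_smul_eq {k : ℕ} (W : Submodule (ZMod 2) (Fin k → ZMod 2))
    {p q : {v : Fin k → ZMod 2 // v ≠ 0}} (hp : p.1 ∉ W) (hq : q.1 ∉ W) :
    ∃ g : GL (Fin k) (ZMod 2), g • p = q ∧
      ∀ w : {v : Fin k → ZMod 2 // v ≠ 0}, w.1 ∈ W → g • w = w := by
  obtain ⟨g, h1, h2⟩ := exists_gl_fixing W hp hq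
  exact ⟨g, Subtype.ext h2, fun w hw => Subtype.ext (h1 _ hw)⟩

theorem gl_transitivityBounds {k : ℕ} (hk : 2 ≤ k) :
    TransitivityBounds (GL (Fin k) (ZMod 2)) {v : Fin k → ZMod 2 // v ≠ 0} thirdPoint := by
  have h4 : 2 ^ 2 ≤ 2 ^ k := Nat.pow_le_pow_right (by norm_num) hk
  have hc := card_nonzero k
  have h01 : ∀ a : ZMod 2, a = 0 ∨ a = 1 := by decide
  have h3 : 3 ≤ Fintype.card {v : Fin k → ZMod 2 // v ≠ 0} := by omega
  have h3' : (3 : ℝ) ≤ Fintype.card {v : Fin k → ZMod 2 // v ≠ 0} := by exact_mod_cast h3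
  have hone : ∀ x y : {v : Fin k → ZMod 2 // v ≠ 0},
      (Fintype.card {v : Fin k → ZMod 2 // v ≠ 0} : ℝ) *
        (∑ g : GL (Fin k) (ZMod 2), if g • x = y then 1 else 0) =
          Fintype.card (GL (Fin k) (ZMod 2)) := by
    intro x y
    have e : ∀ z : {v : Fin k → ZMod 2 // v ≠ 0},
        (∑ g : GL (Fin k) (ZMod 2), if g • z = y then (1 : ℝ) else 0) =
          ∑ g : GL (Fin k) (ZMod 2), if g • x = y then 1 else 0 := by
      intro z
      obtain ⟨a, ha, -⟩ := gl_exists_smul_eq (p := x) (q := z) ⊥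
        (by simpa using x.2) (by simpa using z.2)
      refine Fintype.sum_equiv (Equiv.mulRight a) _ _ fun g => ?_
      simp only [Equiv.coe_mulRight, mul_smul, ha]
    rw [← nsmul_eq_mul, ← Finset.card_univ, ← Finset.sum_const,
      ← Finset.sum_congr rfl fun z _ => e z, Finset.sum_comm]
    simp [smul_eq_iff_eq_inv_smul]
  have htwo : ∀ x x' y y' : {v : Fin k → ZMod 2 // v ≠ 0}, x ≠ x' →
      (Fintype.card {v : Fin k → ZMod 2 // v ≠ 0} : ℝ) *
        (Fintype.card {v : Fin k → ZMod 2 // v ≠ 0} - 1) *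
        (∑ g : GL (Fin k) (ZMod 2), if g • x = y ∧ g • x' = y' then 1 else 0) ≤
          Fintype.card (GL (Fin k) (ZMod 2)) := by
    intro x x' y y' hx
    have hW : ∀ z : {v : Fin k → ZMod 2 // v ≠ 0}, z ≠ x →
        z.1 ∉ Submodule.span (ZMod 2) {x.1} := by
      intro z hz hmem
      obtain ⟨a, ha⟩ := Submodule.mem_span_singleton.1 hmem
      rcases h01 a with rfl | rfl
      · exact z.2 (by simpa using ha.symm)
      · exact hz (Subtype.ext (by simpa using ha.symm))
    have := card_mul_sum_le (G := GL (Fin k) (ZMod 2)) (fun g => g • x = y)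
      (Finset.univ.erase x) y' x' fun p hp => by
        obtain ⟨a, ha, hfix⟩ := gl_exists_smul_eq _ (hW x' hx.symm) (hW p (Finset.ne_of_mem_erase hp))
        refine ⟨a, ha, fun g => ?_⟩
        rw [mul_smul, hfix x (Submodule.mem_span_singleton_self _)]
    rw [Finset.card_erase_of_mem (Finset.mem_univ _), Finset.card_univ,
      Nat.cast_sub (by omega), Nat.cast_one] at this
    rw [← hone x y, mul_assoc]
    gcongr
  refine ⟨h3, ?_, ?_, hone, htwo, ?_⟩
  · rw [hc]
    rcases hk.eq_or_lt with rfl | h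
    · left; rfl
    · right
      have : 2 ^ 3 ≤ 2 ^ k := Nat.pow_le_pow_right (by norm_num) h
      omega
  · intro x y hxy
    refine ⟨fun h => y.2 ?_, fun h => x.2 ?_⟩
    · simpa [thirdPoint_val hxy] using congrArg Subtype.val h
    · simpa [thirdPoint_val hxy] using congrArg Subtype.val h
  · intro x x' x'' y y' y'' hx h1 h2 ht
    have hW : ∀ z : {v : Fin k → ZMod 2 // v ≠ 0}, z ≠ x → z ≠ x' → z ≠ thirdPoint x x' →
        z.1 ∉ Submodule.span (ZMod 2) {x.1, x'.1} := by
      intro z hz hz' hz'' hmem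
      obtain ⟨a, b, hab⟩ := Submodule.mem_span_pair.1 hmem
      rcases h01 a with rfl | rfl <;> rcases h01 b with rfl | rfl
      · exact z.2 (by simpa using hab.symm)
      · exact hz' (Subtype.ext (by simpa using hab.symm))
      · exact hz (Subtype.ext (by simpa using hab.symm))
      · exact hz'' (Subtype.ext (by simpa [thirdPoint_val hx] using hab.symm))
    have hne : thirdPoint x x' ≠ x ∧ thirdPoint x x' ≠ x' := by
      refine ⟨fun h => x'.2 ?_, fun h => x.2 ?_⟩
      · simpa [thirdPoint_val hx] using congrArg Subtype.val h
      · simpa [thirdPoint_val hx] using congrArg Subtype.val h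
    have := card_mul_sum_le (G := GL (Fin k) (ZMod 2)) (fun g => g • x = y ∧ g • x' = y')
      ({x, x', thirdPoint x x'}ᶜ) y'' x'' fun p hp => by
        simp only [Finset.mem_compl, Finset.mem_insert, Finset.mem_singleton, not_or] at hp
        obtain ⟨a, ha, hfix⟩ := gl_exists_smul_eq _ (hW x'' h1 h2 ht) (hW p hp.1 hp.2.1 hp.2.2)
        refine ⟨a, ha, fun g => ?_⟩
        rw [mul_smul, hfix x (Submodule.subset_span (by simp)), mul_smul,
          hfix x' (Submodule.subset_span (by simp))]
    have hcard : ({x, x', thirdPoint x x'} : Finset {v : Fin k → ZMod 2 // v ≠ 0}).card = 3 := by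
      rw [Finset.card_eq_three]
      exact ⟨_, _, _, hx, hne.1.symm, hne.2.symm, rfl⟩
    rw [Finset.card_compl, hcard, Nat.cast_sub h3] at this
    refine le_trans ?_ (htwo x x' y y' hx)
    rw [mul_assoc]
    refine mul_le_mul_of_nonneg_left ?_ (mul_nonneg (by positivity) (by linarith))
    simpa only [and_assoc, Nat.cast_ofNat] using this

end GeneralLinear

section Words

/-- `g` or `g⁻¹`, according to the sign `e`. -/
def signed {G : Type*} [Group G] (e : ZMod 2) (g : G) : G := if e = 0 then g else g⁻¹

theorem signed_eq {G : Type*} [Group G] (e e' : ZMod 2) (g : G) :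
    signed e' g = if e' = e then signed e g else (signed e g)⁻¹ := by
  have h01 : ∀ a : ZMod 2, a = 0 ∨ a = 1 := by decide
  rcases h01 e with rfl | rfl <;> rcases h01 e' with rfl | rfl <;> simp [signed]

theorem sum_signed {G : Type*} [Group G] [Fintype G] (e : ZMod 2) (F : G → ℝ) :
    ∑ g, F (signed e g) = ∑ g, F g := by
  by_cases h : e = 0
  · simp [signed, h]
  · simp only [signed, h, if_false]
    exact Fintype.sum_equiv (Equiv.inv G) _ _ fun g => rfl

/-- The value of a word in signed generators. -/
def wordEval {G β : Type*} [Group G] (s : β → G) (w : List (β × ZMod 2)) : G :=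
  (w.map fun p => signed p.2 (s p.1)).prod

theorem sum_sum_update {G β : Type*} [Fintype G] [Fintype β] [DecidableEq β] (F : (β → G) → ℝ) (b : β) :
    ∑ s : β → G, ∑ g : G, F (Function.update s b g) = Fintype.card G * ∑ s : β → G, F s := by
  have h : ∑ s : β → G, ∑ g : G, F (Function.update s b g) = ∑ s : β → G, ∑ _g : G, F s := by
    rw [← Fintype.sum_prod_type', ← Fintype.sum_prod_type']
    let e : (β → G) × G → (β → G) × G := fun q => (Function.update q.1 b q.2, q.1 b)
    have he : Function.Involutive e := fun q => by
      simp [e]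
    exact Fintype.sum_equiv he.toPerm _ _ fun q => rfl
  rw [h]
  simp [Finset.mul_sum]

variable {G β : Type*} [Group G]

theorem wordEval_append (s : β → G) (u v : List (β × ZMod 2)) :
    wordEval s (u ++ v) = wordEval s u * wordEval s v := by
  simp [wordEval]

theorem wordEval_cons (s : β → G) (p : β × ZMod 2) (v : List (β × ZMod 2)) :
    wordEval s (p :: v) = signed p.2 (s p.1) * wordEval s v := by
  simp [wordEval]

theorem wordEval_update [DecidableEq β] (s : β → G) (b : β) (g : G) (u : List (β × ZMod 2))
    (h : ∀ p ∈ u, p.1 ≠ b) : wordEval (Function.update s b g) u = wordEval s u := by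
  unfold wordEval
  congr 1
  refine List.map_congr_left fun p hp => ?_
  rw [Function.update_of_ne (h p hp)]

theorem sum_le_of_update [Fintype G] [Fintype β] [DecidableEq β] (F : (β → G) → ℝ) (b : β) (c : ℝ)
    (h : ∀ s, ∑ g : G, F (Function.update s b g) ≤ c * Fintype.card G) :
    ∑ s : β → G, F s ≤ c * (Fintype.card G : ℝ) ^ Fintype.card β := by
  have h1 := Finset.sum_le_sum fun s (_ : s ∈ Finset.univ) => h s
  rw [sum_sum_update] at h1
  have hK : (0 : ℝ) < Fintype.card G := by exact_mod_cast Fintype.card_pos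
  have : (Finset.univ : Finset (β → G)).card = Fintype.card G ^ Fintype.card β := by simp
  rw [Finset.sum_const, this, nsmul_eq_mul] at h1
  push_cast at h1
  nlinarith

theorem sum_le_of_update_update [Fintype G] [Fintype β] [DecidableEq β] (F : (β → G) → ℝ) (a b : β)
    (c : ℝ) (h : ∀ s, ∑ k : G, ∑ g : G, F (Function.update (Function.update s b k) a g) ≤
      c * (Fintype.card G : ℝ) ^ 2) :
    ∑ s : β → G, F s ≤ c * (Fintype.card G : ℝ) ^ Fintype.card β := by
  have hK : (0 : ℝ) < Fintype.card G := by exact_mod_cast Fintype.card_pos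
  have h1 := sum_le_of_update (fun s => ∑ g : G, F (Function.update s a g)) b
    (c * Fintype.card G) fun s => (h s).trans (le_of_eq (by ring))
  rw [sum_sum_update] at h1
  nlinarith

theorem drop_ofFn_split {X : Type*} {L : ℕ} (q : Fin L → X) (a : ℕ) (x : Fin L) (h : a ≤ x) :
    ∃ u, (List.ofFn q).drop a = u ++ q x :: (List.ofFn q).drop (x + 1) ∧
      ∀ p ∈ u, ∃ j : Fin L, a ≤ j ∧ j < x ∧ q j = p := by
  refine ⟨((List.ofFn q).drop a).take (x - a), ?_, ?_⟩
  · conv_lhs => rw [← List.take_append_drop (x - a) ((List.ofFn q).drop a)]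
    rw [List.drop_drop, Nat.add_sub_cancel' h,
      List.drop_eq_getElem_cons (by simp : (x : ℕ) < (List.ofFn q).length)]
    simp
  · intro p hp
    obtain ⟨i, hi, rfl⟩ := List.mem_iff_getElem.1 hp
    simp only [List.length_take, List.length_drop, List.length_ofFn] at hi
    refine ⟨⟨a + i, by omega⟩, by simp, ?_, by simp⟩
    rw [Fin.lt_def]
    simp only
    omega

theorem mem_drop_ofFn {X : Type*} {L : ℕ} (q : Fin L → X) (a : ℕ) (p : X)
    (h : p ∈ (List.ofFn q).drop a) : ∃ j : Fin L, a ≤ j ∧ q j = p := by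
  obtain ⟨i, hi, rfl⟩ := List.mem_iff_getElem.1 h
  simp only [List.length_drop, List.length_ofFn] at hi
  exact ⟨⟨a + i, by omega⟩, by simp, by simp⟩

/-- The word with letters `f j` and signs `ε j`. -/
def signedWord {L : ℕ} (f : Fin L → β) (ε : Fin L → ZMod 2) : List (β × ZMod 2) :=
  List.ofFn fun j => (f j, ε j)

variable {Ω : Type*} [Fintype Ω] [DecidableEq Ω] [MulAction G Ω] [Fintype G] [Fintype β]

variable [DecidableEq β] {L : ℕ}

/-- The total number of fixed points of a word over all choices of generators. -/
noncomputable def totalFix (G : Type*) [Group G] [Fintype G] (Ω : Type*) [Fintype Ω] [DecidableEq Ω]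
    [MulAction G Ω] {β : Type*} [Fintype β] [DecidableEq β] {L : ℕ} (f : Fin L → β)
    (ε : Fin L → ZMod 2) : ℝ :=
  ∑ s : β → G, fixCount Ω (wordEval s (signedWord f ε))

theorem totalFix_le_card (f : Fin L → β) (ε : Fin L → ZMod 2) :
    totalFix G Ω f ε ≤ Fintype.card Ω * (Fintype.card G : ℝ) ^ Fintype.card β := by
  refine (Finset.sum_le_sum fun s _ => fixCount_le _).trans (le_of_eq ?_)
  simp [mul_comm]

namespace TransitivityBounds

variable {t : Ω → Ω → Ω} (H : TransitivityBounds G Ω t)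
include H

theorem totalFix_le_of_once (f : Fin L → β) (ε : Fin L → ZMod 2) (x : Fin L)
    (hx : ∀ j, f j = f x → j = x) :
    totalFix G Ω f ε ≤ 1 * (Fintype.card G : ℝ) ^ Fintype.card β := by
  refine sum_le_of_update _ (f x) _ fun s => ?_
  obtain ⟨u, hu, hu'⟩ := drop_ofFn_split (fun j => (f j, ε j)) 0 x (Nat.zero_le _)
  have hv : ∀ p ∈ (List.ofFn fun j => (f j, ε j)).drop (x + 1), p.1 ≠ f x := by
    intro p hp e
    obtain ⟨j, hj, rfl⟩ := mem_drop_ofFn _ _ _ hp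
    have := hx j e
    omega
  have hu'' : ∀ p ∈ u, p.1 ≠ f x := by
    intro p hp e
    obtain ⟨j, -, hj, rfl⟩ := hu' p hp
    exact hj.ne (hx j e)
  rw [List.drop_zero] at hu
  generalize (List.ofFn fun j => (f j, ε j)).drop (x + 1) = r at hu hv
  simp only [signedWord, hu, wordEval_append, wordEval_cons, wordEval_update _ _ _ _ hu'',
    wordEval_update _ _ _ _ hv, Function.update_self, ← mul_assoc]
  rw [sum_signed (ε x) fun g => fixCount Ω (wordEval s u * g *
    wordEval s r), H.sum_fixCount_one, one_mul]

theorem totalFix_le_of_twice (f : Fin L → β) (ε : Fin L → ZMod 2) (x y : Fin L) (hxy : x < y)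
    (hf : f y = f x) (hx : ∀ j, f j = f x → j = x ∨ j = y) (hε : ε y = ε x) :
    totalFix G Ω f ε ≤ 2 * (Fintype.card G : ℝ) ^ Fintype.card β := by
  refine sum_le_of_update _ (f x) _ fun s => ?_
  obtain ⟨u, hu, hu'⟩ := drop_ofFn_split (fun j => (f j, ε j)) 0 x (Nat.zero_le _)
  obtain ⟨v, hv, hv'⟩ := drop_ofFn_split (fun j => (f j, ε j)) (x + 1) y hxy
  have hw : ∀ p ∈ (List.ofFn fun j => (f j, ε j)).drop (y + 1), p.1 ≠ f x := by
    intro p hp e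
    obtain ⟨j, hj, rfl⟩ := mem_drop_ofFn _ _ _ hp
    have := hx j e
    omega
  have hv'' : ∀ p ∈ v, p.1 ≠ f x := by
    intro p hp e
    obtain ⟨j, hj, hj', rfl⟩ := hv' p hp
    have := hx j e
    omega
  have hu'' : ∀ p ∈ u, p.1 ≠ f x := by
    intro p hp e
    obtain ⟨j, -, hj, rfl⟩ := hu' p hp
    have := hx j e
    omega
  rw [List.drop_zero, hv] at hu
  generalize (List.ofFn fun j => (f j, ε j)).drop (y + 1) = r at hu hw
  simp only [signedWord, hu, wordEval_append, wordEval_cons, wordEval_update _ _ _ _ hu'',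
    wordEval_update _ _ _ _ hv'', wordEval_update _ _ _ _ hw, hf, hε, Function.update_self]
  generalize wordEval s r = c
  rw [sum_signed (ε x) fun g => fixCount Ω (wordEval s u * (g * (wordEval s v * (g * c))))]
  refine le_trans (le_of_eq ?_) (H.sum_fixCount_same_le (wordEval s v) (c * wordEval s u))
  refine Finset.sum_congr rfl fun g _ => ?_
  rw [fixCount_mul_comm]
  simp only [mul_assoc]

theorem totalFix_le_of_thrice (f : Fin L → β) (ε : Fin L → ZMod 2) (x y z : Fin L) (hxy : x < y)
    (hyz : y < z) (hf : f y = f x) (hf' : f z = f x)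
    (hx : ∀ j, f j = f x → j = x ∨ j = y ∨ j = z) :
    totalFix G Ω f ε ≤ 5 * (Fintype.card G : ℝ) ^ Fintype.card β := by
  refine sum_le_of_update _ (f x) _ fun s => ?_
  obtain ⟨u, hu, hu'⟩ := drop_ofFn_split (fun j => (f j, ε j)) 0 x (Nat.zero_le _)
  obtain ⟨v, hv, hv'⟩ := drop_ofFn_split (fun j => (f j, ε j)) (x + 1) y hxy
  obtain ⟨w, hw, hw'⟩ := drop_ofFn_split (fun j => (f j, ε j)) (y + 1) z hyz
  have hr : ∀ p ∈ (List.ofFn fun j => (f j, ε j)).drop (z + 1), p.1 ≠ f x := by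
    intro p hp e
    obtain ⟨j, hj, rfl⟩ := mem_drop_ofFn _ _ _ hp
    have := hx j e
    omega
  have hw'' : ∀ p ∈ w, p.1 ≠ f x := by
    intro p hp e
    obtain ⟨j, hj, hj', rfl⟩ := hw' p hp
    have := hx j e
    omega
  have hv'' : ∀ p ∈ v, p.1 ≠ f x := by
    intro p hp e
    obtain ⟨j, hj, hj', rfl⟩ := hv' p hp
    have := hx j e
    omega
  have hu'' : ∀ p ∈ u, p.1 ≠ f x := by
    intro p hp e
    obtain ⟨j, -, hj, rfl⟩ := hu' p hp
    have := hx j e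
    omega
  rw [List.drop_zero, hv, hw] at hu
  generalize (List.ofFn fun j => (f j, ε j)).drop (z + 1) = r at hu hr
  simp only [signedWord, hu, wordEval_append, wordEval_cons, wordEval_update _ _ _ _ hu'',
    wordEval_update _ _ _ _ hv'', wordEval_update _ _ _ _ hw'', wordEval_update _ _ _ _ hr, hf,
    hf', Function.update_self]
  generalize wordEval s r = c
  simp only [signed_eq (ε x) (ε y), signed_eq (ε x) (ε z)]
  rw [sum_signed (ε x) fun g => fixCount Ω (wordEval s u * (g * (wordEval s v *
    ((if ε y = ε x then g else g⁻¹) * (wordEval s w * ((if ε z = ε x then g else g⁻¹) * c))))))]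
  refine le_trans (le_of_eq ?_) (H.sum_fixCount_three (wordEval s u) (wordEval s v)
    (wordEval s w) c (decide (ε y = ε x)) (decide (ε z = ε x)))
  simp only [mul_assoc, decide_eq_true_eq]

/-- Two interleaved generators occurring twice each, the second one with opposite signs. -/
theorem totalFix_le_of_cross (f : Fin L → β) (ε : Fin L → ZMod 2) (x y x' y' : Fin L)
    (h1 : x < y) (h2 : y < x') (h3 : x' < y') (hab : f x ≠ f y)
    (hf : f x' = f x) (hf' : f y' = f y) (hx : ∀ j, f j = f x → j = x ∨ j = x')
    (hy : ∀ j, f j = f y → j = y ∨ j = y') (hε : ε y' ≠ ε y) :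
    totalFix G Ω f ε ≤
      (1 + 1 / (Fintype.card Ω - 1)) * (Fintype.card G : ℝ) ^ Fintype.card β := by
  refine sum_le_of_update_update _ (f x) (f y) _ fun s => ?_
  obtain ⟨u, hu, hu'⟩ := drop_ofFn_split (fun j => (f j, ε j)) 0 x (Nat.zero_le _)
  obtain ⟨v, hv, hv'⟩ := drop_ofFn_split (fun j => (f j, ε j)) (x + 1) y h1
  obtain ⟨w, hw, hw'⟩ := drop_ofFn_split (fun j => (f j, ε j)) (y + 1) x' h2
  obtain ⟨z, hz, hz'⟩ := drop_ofFn_split (fun j => (f j, ε j)) (x' + 1) y' h3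
  have hr : ∀ p ∈ (List.ofFn fun j => (f j, ε j)).drop (y' + 1), p.1 ≠ f x ∧ p.1 ≠ f y := by
    intro p hp
    obtain ⟨j, hj, rfl⟩ := mem_drop_ofFn _ _ _ hp
    exact ⟨fun e => by have := hx j e; omega, fun e => by have := hy j e; omega⟩
  have hz'' : ∀ p ∈ z, p.1 ≠ f x ∧ p.1 ≠ f y := by
    intro p hp
    obtain ⟨j, hj, hj', rfl⟩ := hz' p hp
    exact ⟨fun e => by have := hx j e; omega, fun e => by have := hy j e; omega⟩
  have hw'' : ∀ p ∈ w, p.1 ≠ f x ∧ p.1 ≠ f y := by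
    intro p hp
    obtain ⟨j, hj, hj', rfl⟩ := hw' p hp
    exact ⟨fun e => by have := hx j e; omega, fun e => by have := hy j e; omega⟩
  have hv'' : ∀ p ∈ v, p.1 ≠ f x ∧ p.1 ≠ f y := by
    intro p hp
    obtain ⟨j, hj, hj', rfl⟩ := hv' p hp
    exact ⟨fun e => by have := hx j e; omega, fun e => by have := hy j e; omega⟩
  have hu'' : ∀ p ∈ u, p.1 ≠ f x ∧ p.1 ≠ f y := by
    intro p hp
    obtain ⟨j, hj, hj', rfl⟩ := hu' p hp
    exact ⟨fun e => by have := hx j e; omega, fun e => by have := hy j e; omega⟩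
  have hupd : ∀ (l : List (β × ZMod 2)), (∀ p ∈ l, p.1 ≠ f x ∧ p.1 ≠ f y) → ∀ k g : G,
      wordEval (Function.update (Function.update s (f y) k) (f x) g) l = wordEval s l := by
    intro l hl k g
    rw [wordEval_update _ _ _ _ fun p hp => (hl p hp).1,
      wordEval_update _ _ _ _ fun p hp => (hl p hp).2]
  have hself : ∀ k g : G, Function.update (Function.update s (f y) k) (f x) g (f y) = k := by
    intro k g
    rw [Function.update_of_ne hab.symm, Function.update_self]
  rw [List.drop_zero, hv, hw, hz] at hu
  generalize (List.ofFn fun j => (f j, ε j)).drop (y' + 1) = r at hu hr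
  simp only [signedWord, hu, wordEval_append, wordEval_cons, hupd _ hu'', hupd _ hv'',
    hupd _ hw'', hupd _ hz'', hupd _ hr, hf, hf', Function.update_self, hself]
  generalize wordEval s r = c
  simp only [signed_eq (ε x) (ε x'), signed_eq (ε y) (ε y'), hε, if_false]
  rw [sum_signed (ε y) fun k => ∑ g : G, fixCount Ω (wordEval s u * (signed (ε x) g *
    (wordEval s v * (k * (wordEval s w *
    ((if ε x' = ε x then signed (ε x) g else (signed (ε x) g)⁻¹) * (wordEval s z *
      (k⁻¹ * c))))))))]
  simp only [fun k => sum_signed (ε x) fun g => fixCount Ω (wordEval s u * (g *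
    (wordEval s v * (k * (wordEval s w *
    ((if ε x' = ε x then g else g⁻¹) * (wordEval s z * (k⁻¹ * c))))))))]
  by_cases hs : ε x' = ε x
  · refine le_trans (le_of_eq ?_) (H.sum_fixCount_same_opp (wordEval s u) (wordEval s v)
      (wordEval s w) (wordEval s z) c)
    simp only [hs, if_true, mul_assoc]
  · refine le_trans (le_of_eq ?_) (H.sum_fixCount_opp_opp (wordEval s u) (wordEval s v)
      (wordEval s w) (wordEval s z) c)
    simp only [hs, if_false, mul_assoc]

end TransitivityBounds

end Words

section Signs

/-- The number of occurrences of the letter `b` in `f`. -/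
def letterCount {α β : Type*} [Fintype α] [DecidableEq β] (f : α → β) (b : β) : ℕ :=
  (Finset.univ.filter fun x => f x = b).card

/-- The letters occurring exactly `p` times. -/
def lettersWithCount {α β : Type*} [Fintype α] [Fintype β] [DecidableEq β] (p : ℕ) (f : α → β) :
    Finset β :=
  Finset.univ.filter fun b => letterCount f b = p

/-- No two distinct letters interleave as `a b a b`. -/
def IsNoncrossing {α β : Type*} [LinearOrder α] (f : α → β) : Prop :=
  ∀ x y x' y' : α, x < y → y < x' → x' < y' → f x' = f x → f y' = f y → f x = f y

variable {β : Type*} [DecidableEq β] {L : ℕ}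

/-- The sum of the signs of each letter in `D`. -/
def signSum (f : Fin L → β) (D : Finset β) : (Fin L → ZMod 2) →+ (D → ZMod 2) where
  toFun ε b := ∑ j ∈ Finset.univ.filter (fun j => f j = b.1), ε j
  map_zero' := by ext b; simp
  map_add' ε ε' := by ext b; simp [Finset.sum_add_distrib]

theorem signSum_apply (f : Fin L → β) (D : Finset β) (ε : Fin L → ZMod 2) (b : D) :
    signSum f D ε b = ∑ j ∈ Finset.univ.filter (fun j => f j = b.1), ε j := rfl

theorem signSum_surjective (f : Fin L → β) (D : Finset β) (hD : ∀ b ∈ D, ∃ x, f x = b) :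
    Function.Surjective (signSum f D) := by
  intro τ
  choose pos hpos using hD
  refine ⟨fun j => if h : f j ∈ D then (if j = pos (f j) h then τ ⟨f j, h⟩ else 0) else 0, ?_⟩
  ext b
  rw [signSum_apply, Finset.sum_eq_single (pos b.1 b.2)]
  · simp [hpos b.1 b.2]
  · intro j hj hne
    obtain ⟨b, hb⟩ := b
    obtain rfl : f j = b := by simpa using hj
    rw [dif_pos hb, if_neg hne]
  · intro h
    exact absurd (by simp [hpos b.1 b.2]) h

theorem card_signSum_fiber (f : Fin L → β) (D : Finset β) (hD : ∀ b ∈ D, ∃ x, f x = b)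
    (τ : D → ZMod 2) :
    (Finset.univ.filter fun ε => signSum f D ε = τ).card * 2 ^ D.card = 2 ^ L := by
  have h1 : ∀ τ', (Finset.univ.filter fun ε => signSum f D ε = τ').card =
      (Finset.univ.filter fun ε => signSum f D ε = τ).card := fun τ' =>
    AddMonoidHom.card_fiber_eq_of_mem_range _ (signSum_surjective f D hD τ')
      (signSum_surjective f D hD τ)
  have h2 := Finset.card_eq_sum_card_fiberwise (f := signSum f D) (s := Finset.univ)
    (t := Finset.univ) fun _ _ => Finset.mem_coe.2 (Finset.mem_univ _)
  simp only [h1, Finset.sum_const, Finset.card_univ, Fintype.card_pi, ZMod.card,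
    Finset.prod_const, Fintype.card_coe, smul_eq_mul, Fintype.card_fin] at h2
  rw [h2, mul_comm]

theorem exists_pair_of_letterCount_eq_two (f : Fin L → β) (b : β) (h : letterCount f b = 2) :
    ∃ x y : Fin L, x < y ∧ Finset.univ.filter (fun j => f j = b) = {x, y} := by
  obtain ⟨x, y, hne, e⟩ := Finset.card_eq_two.1 h
  rcases lt_or_gt_of_ne hne with h | h
  · exact ⟨x, y, h, e⟩
  · exact ⟨y, x, h, by rw [e, Finset.pair_comm]⟩

theorem exists_triple_of_letterCount_eq_three (f : Fin L → β) (b : β) (h : letterCount f b = 3) :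
    ∃ x y z : Fin L, x < y ∧ y < z ∧ Finset.univ.filter (fun j => f j = b) = {x, y, z} := by
  let e := (Finset.univ.filter fun j => f j = b).orderIsoOfFin h
  refine ⟨e 0, e 1, e 2, ?_, ?_, ?_⟩
  · exact_mod_cast e.strictMono (by decide : (0 : Fin 3) < 1)
  · exact_mod_cast e.strictMono (by decide : (1 : Fin 3) < 2)
  · ext j
    constructor
    · intro hj
      obtain ⟨i, hi⟩ := e.surjective ⟨j, hj⟩
      have : j = (e i).1 := by rw [hi]
      rw [this]
      fin_cases i <;> simp
    · intro hj
      simp only [Finset.mem_insert, Finset.mem_singleton] at hj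
      rcases hj with rfl | rfl | rfl <;> exact (e _).2

variable [Fintype β] {G Ω : Type*} [Group G] [Fintype G] [Fintype Ω] [DecidableEq Ω] [MulAction G Ω]

namespace TransitivityBounds

variable {t : Ω → Ω → Ω} (H : TransitivityBounds G Ω t)
include H

theorem totalFix_le_of_letterCount_eq_one (f : Fin L → β) (ε : Fin L → ZMod 2) (b : β)
    (h : letterCount f b = 1) :
    totalFix G Ω f ε ≤ 1 * (Fintype.card G : ℝ) ^ Fintype.card β := by
  obtain ⟨x, hx⟩ := Finset.card_eq_one.1 h
  have hm : ∀ j, f j = b ↔ j = x := fun j => by simpa using Finset.ext_iff.1 hx j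
  obtain rfl : f x = b := (hm x).2 rfl
  exact H.totalFix_le_of_once f ε x fun j => (hm j).1

theorem totalFix_le_of_letterCount_eq_three (f : Fin L → β) (ε : Fin L → ZMod 2) (b : β)
    (h : letterCount f b = 3) :
    totalFix G Ω f ε ≤ 5 * (Fintype.card G : ℝ) ^ Fintype.card β := by
  obtain ⟨x, y, z, hxy, hyz, hx⟩ := exists_triple_of_letterCount_eq_three f b h
  have hm : ∀ j, f j = b ↔ j = x ∨ j = y ∨ j = z := fun j => by simpa using Finset.ext_iff.1 hx j
  obtain rfl : f x = b := (hm x).2 (by simp)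
  exact H.totalFix_le_of_thrice f ε x y z hxy hyz ((hm y).2 (by simp)) ((hm z).2 (by simp))
    fun j => (hm j).1

theorem totalFix_le_of_signSum_ne (f : Fin L → β) (ε : Fin L → ZMod 2)
    (h : signSum f (lettersWithCount 2 f) ε ≠ fun _ => 1) :
    totalFix G Ω f ε ≤ 2 * (Fintype.card G : ℝ) ^ Fintype.card β := by
  obtain ⟨b, hb⟩ := Function.ne_iff.1 h
  have h01 : ∀ a c : ZMod 2, a + c ≠ 1 → c = a := by decide
  obtain ⟨x, y, hxy, hx⟩ := exists_pair_of_letterCount_eq_two f b.1 (Finset.mem_filter.1 b.2).2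
  have hm : ∀ j, f j = b.1 ↔ j = x ∨ j = y := fun j => by simpa using Finset.ext_iff.1 hx j
  have hfx : f x = b.1 := (hm x).2 (by simp)
  rw [signSum_apply, hx, Finset.sum_pair hxy.ne] at hb
  exact H.totalFix_le_of_twice f ε x y hxy (by rw [hfx]; exact (hm y).2 (by simp))
    (fun j => by rw [hfx]; exact (hm j).1) (h01 _ _ hb)

/-- Sum over all signs, when the letters occurring twice do interleave. -/
theorem sum_totalFix_le_of_crossing (f : Fin L → β) (x y x' y' : Fin L)
    (h1 : x < y) (h2 : y < x') (h3 : x' < y') (hab : f x ≠ f y)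
    (hf : f x' = f x) (hf' : f y' = f y) (hx : letterCount f (f x) = 2)
    (hy : letterCount f (f y) = 2) :
    ∑ ε, totalFix G Ω f ε ≤ (Fintype.card G : ℝ) ^ Fintype.card β * 2 ^ L *
      (2 * (1 - 1 / 2 ^ (lettersWithCount 2 f).card) + 1 / 2 ^ (lettersWithCount 2 f).card) := by
  set D := lettersWithCount 2 f with hD
  set N := (Fintype.card G : ℝ) ^ Fintype.card β with hN
  have hN0 : 0 ≤ N := by positivity
  have hn := H.card_pos
  have hxD : f x ∈ D := Finset.mem_filter.2 ⟨Finset.mem_univ _, hx⟩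
  have hyD : f y ∈ D := Finset.mem_filter.2 ⟨Finset.mem_univ _, hy⟩
  have fiber : ∀ {u v : Fin L}, u < v → f v = f u → letterCount f (f u) = 2 →
      Finset.univ.filter (fun j => f j = f u) = {u, v} := by
    intro u v huv e hc
    refine (Finset.eq_of_subset_of_card_le ?_ ?_).symm
    · intro j hj
      simp only [Finset.mem_insert, Finset.mem_singleton] at hj
      rcases hj with rfl | rfl <;> simp [e]
    · rw [Finset.card_pair huv.ne]; exact hc.le
  have fx := fiber (h1.trans h2) hf hx
  have fy := fiber (h2.trans h3) hf' hy
  have mx : ∀ j, f j = f x → j = x ∨ j = x' := fun j => by simpa using (Finset.ext_iff.1 fx j).1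
  have my : ∀ j, f j = f y → j = y ∨ j = y' := fun j => by simpa using (Finset.ext_iff.1 fy j).1
  let τ : Bool → D → ZMod 2 := fun c b => if c ∧ b.1 = f x then 0 else 1
  have hτ : τ true ≠ τ false := fun e => by
    have := congrFun e ⟨f x, hxD⟩
    simp [τ] at this
  let A : Bool → Finset (Fin L → ZMod 2) := fun c => Finset.univ.filter fun ε => signSum f D ε = τ c
  have hdisj : Disjoint (A true) (A false) := by
    rw [Finset.disjoint_left]
    intro ε h h'
    exact hτ ((Finset.mem_filter.1 h).2.symm.trans (Finset.mem_filter.1 h').2)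
  have hDpos : ∀ b ∈ D, ∃ x, f x = b := by
    intro b hb
    obtain ⟨u, v, -, e⟩ := exists_pair_of_letterCount_eq_two f b (Finset.mem_filter.1 hb).2
    exact ⟨u, by simpa using (Finset.ext_iff.1 e u).2 (by simp)⟩
  have hcard : ∀ c, ((A c).card : ℝ) = 2 ^ L / 2 ^ D.card := fun c => by
    rw [eq_div_iff (by positivity)]
    exact_mod_cast card_signSum_fiber f D hDpos (τ c)
  have hb : ∀ ε, totalFix G Ω f ε ≤ 2 * N +
      ((if ε ∈ A true then 1 else 0) + (if ε ∈ A false then 1 else 0)) *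
        ((1 / (Fintype.card Ω - 1) - 1) * N) := by
    intro ε
    have small : ∀ c, ε ∈ A c → totalFix G Ω f ε ≤ (1 + 1 / (Fintype.card Ω - 1)) * N := by
      intro c hc
      refine H.totalFix_le_of_cross f ε x y x' y' h1 h2 h3 hab hf hf' mx my fun e => ?_
      have e2 := congrFun (Finset.mem_filter.1 hc).2 ⟨f y, hyD⟩
      rw [signSum_apply, fy, Finset.sum_pair (h2.trans h3).ne, e, CharTwo.add_self_eq_zero] at e2
      simp [τ, hab.symm] at e2
    by_cases ht : ε ∈ A true
    · have hnf : ε ∉ A false := Finset.disjoint_left.1 hdisj ht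
      rw [if_pos ht, if_neg hnf]
      linarith [small true ht]
    · by_cases hf : ε ∈ A false
      · rw [if_neg ht, if_pos hf]
        linarith [small false hf]
      · rw [if_neg ht, if_neg hf, add_zero, zero_mul, add_zero]
        refine H.totalFix_le_of_signSum_ne f ε fun e => hf (Finset.mem_filter.2 ⟨Finset.mem_univ _, ?_⟩)
        exact e.trans (by ext b; simp [τ])
  refine (Finset.sum_le_sum fun ε _ => hb ε).trans ?_
  simp only [Finset.sum_add_distrib, ← Finset.sum_mul, Finset.sum_ite_mem, Finset.univ_inter, Finset.sum_const, nsmul_eq_mul, mul_one, hcard,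
    Finset.card_univ, Fintype.card_pi, ZMod.card, Finset.prod_const, Fintype.card_fin]
  have h12 : (1 : ℝ) / (Fintype.card Ω - 1) ≤ 1 / 2 := by
    apply one_div_le_one_div_of_le <;> linarith
  have hq : (0 : ℝ) ≤ 2 ^ L / 2 ^ D.card * N := by positivity
  have e1 : N * 2 ^ L * (2 * (1 - 1 / 2 ^ D.card) + 1 / 2 ^ D.card) =
      2 ^ L * (2 * N) - 2 ^ L / 2 ^ D.card * N := by ring
  rw [e1]
  push_cast
  nlinarith

/-- Sum over all signs, given a bound valid for every sign. -/
theorem sum_totalFix_le_of_le (f : Fin L → β) (c : ℝ)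
    (hc : ∀ ε, totalFix G Ω f ε ≤ c * (Fintype.card G : ℝ) ^ Fintype.card β) :
    ∑ ε, totalFix G Ω f ε ≤ (Fintype.card G : ℝ) ^ Fintype.card β * 2 ^ L *
      (2 * (1 - 1 / 2 ^ (lettersWithCount 2 f).card) +
        c * (1 / 2 ^ (lettersWithCount 2 f).card)) := by
  set D := lettersWithCount 2 f with hD
  set N := (Fintype.card G : ℝ) ^ Fintype.card β with hN
  let A : Finset (Fin L → ZMod 2) := Finset.univ.filter fun ε => signSum f D ε = fun _ => 1
  have hDpos : ∀ b ∈ D, ∃ x, f x = b := by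
    intro b hb
    obtain ⟨u, v, -, e⟩ := exists_pair_of_letterCount_eq_two f b (Finset.mem_filter.1 hb).2
    exact ⟨u, by simpa using (Finset.ext_iff.1 e u).2 (by simp)⟩
  have hcard : (A.card : ℝ) = 2 ^ L / 2 ^ D.card := by
    rw [eq_div_iff (by positivity)]
    exact_mod_cast card_signSum_fiber f D hDpos _
  have hb : ∀ ε, totalFix G Ω f ε ≤ 2 * N + (if ε ∈ A then 1 else 0) * ((c - 2) * N) := by
    intro ε
    by_cases h : ε ∈ A
    · rw [if_pos h]; linarith [hc ε]
    · rw [if_neg h, zero_mul, add_zero]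
      exact H.totalFix_le_of_signSum_ne f ε fun e => h (Finset.mem_filter.2 ⟨Finset.mem_univ _, e⟩)
  refine (Finset.sum_le_sum fun ε _ => hb ε).trans (le_of_eq ?_)
  simp only [Finset.sum_add_distrib, ← Finset.sum_mul, Finset.sum_ite_mem, Finset.univ_inter, Finset.sum_const, nsmul_eq_mul, mul_one, hcard,
    Finset.card_univ, Fintype.card_pi, ZMod.card, Finset.prod_const, Fintype.card_fin]
  push_cast
  ring

end TransitivityBounds

end Signs

section Counting

open Finset

theorem letterCount_subtypeMap {α β : Type*} [Fintype α] [DecidableEq β] (f : α → β)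
    (P : α → Prop) [Fintype (Subtype P)] (Q : β → Prop) (h : ∀ x, P x ↔ Q (f x)) (b : Subtype Q) :
    letterCount (Subtype.map f fun x => (h x).1 : Subtype P → Subtype Q) b = letterCount f b.1 := by
  refine card_bij (fun x _ => x.1) ?_ (fun x _ y _ e => Subtype.ext e) ?_
  · intro x hx
    simpa [Subtype.ext_iff] using hx
  · intro x hx
    have hx' : f x = b.1 := by simpa using hx
    exact ⟨⟨x, (h x).2 (hx' ▸ b.2)⟩, by simpa [Subtype.ext_iff] using hx', rfl⟩

theorem card_preimage_lettersWithCount {α β : Type*} [Fintype α] [Fintype β] [DecidableEq β]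
    (f : α → β) (p : ℕ) :
    (univ.filter fun x => f x ∈ lettersWithCount p f).card = p * (lettersWithCount p f).card := by
  rw [card_eq_sum_card_fiberwise (f := f) (t := lettersWithCount p f)
    fun x hx => mem_coe.2 (mem_filter.1 (mem_coe.1 hx)).2, mul_comm]
  refine sum_const_nat fun b hb => ?_
  rw [filter_filter]
  refine Eq.trans (congrArg card ?_) (mem_filter.1 hb).2
  ext x
  simp only [mem_filter, mem_univ, true_and, and_iff_right_iff_imp]
  rintro rfl
  exact hb

/-- A function splits into its part on the letters occurring `p` times and the rest. -/
theorem card_le_of_splitting {α β : Type*} [Fintype α] [DecidableEq α] [Fintype β] [DecidableEq β]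
    (p i : ℕ) (F : Finset (α → β))
    (PG : ∀ (S : Finset β) (T : Finset α), (T → S) → Prop)
    (PH : ∀ (S : Finset β) (T : Finset α), ({x // x ∉ T} → {b // b ∉ S}) → Prop)
    (hF : ∀ f ∈ F, (lettersWithCount p f).card = i)
    (hFG : ∀ f ∈ F, ∀ (T : Finset α) (h : ∀ x, x ∈ T ↔ f x ∈ lettersWithCount p f),
      PG _ T (Subtype.map f fun x => (h x).1))
    (hFH : ∀ f ∈ F, ∀ (T : Finset α) (h : ∀ x, x ∉ T ↔ f x ∉ lettersWithCount p f),
      PH _ T (Subtype.map f fun x => (h x).1))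
    (cg ch : ℕ)
    (hg : ∀ S T, S.card = i → T.card = p * i → Nat.card {g // PG S T g} ≤ cg)
    (hh : ∀ S T, S.card = i → T.card = p * i → Nat.card {h // PH S T h} ≤ ch) :
    F.card ≤ (Fintype.card β).choose i * (Fintype.card α).choose (p * i) * (cg * ch) := by
  classical
  let key : (α → β) → Finset β × Finset α := fun f =>
    (lettersWithCount p f, univ.filter fun x => f x ∈ lettersWithCount p f)
  have hkey : ∀ f ∈ F, key f ∈ powersetCard i univ ×ˢ powersetCard (p * i) univ := by
    intro f hf
    simp only [key, mem_product, mem_powersetCard, subset_univ,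
      card_preimage_lettersWithCount, hF f hf, and_self]
  rw [card_eq_sum_card_fiberwise (f := key) hkey]
  refine (sum_le_card_nsmul _ _ (cg * ch) ?_).trans (le_of_eq ?_)
  · rintro ⟨S, T⟩ hST
    simp only [mem_product, mem_powersetCard, subset_univ, true_and] at hST
    refine le_trans ?_ (Nat.mul_le_mul (hg S T hST.1 hST.2) (hh S T hST.1 hST.2))
    rw [← Nat.card_prod, Nat.card_eq_fintype_card, ← card_univ]
    refine (card_le_card (t := univ.image fun q : {g // PG S T g} × {h // PH S T h} =>
      fun x => if hx : x ∈ T then (q.1.1 ⟨x, hx⟩).1 else (q.2.1 ⟨x, hx⟩).1) ?_).trans card_image_le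
    intro f hf
    obtain ⟨hfF, hfk⟩ := mem_filter.1 hf
    obtain ⟨rfl, rfl⟩ : lettersWithCount p f = S ∧ _ = T := Prod.ext_iff.1 hfk
    have hT : ∀ x, x ∈ (key f).2 ↔ f x ∈ lettersWithCount p f := fun x => by simp [key]
    refine mem_image.2 ⟨(⟨_, hFG f hfF _ hT⟩, ⟨_, hFH f hfF _ fun x => not_congr (hT x)⟩),
      mem_univ _, ?_⟩
    funext x
    split_ifs <;> rfl
  · rw [card_product, card_powersetCard, card_powersetCard, card_univ, card_univ, smul_eq_mul]

/-- Functions all of whose fibres have size `p`. -/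
theorem card_letterCount_eq_mul_le {α β : Type*} [Fintype α] [DecidableEq α] [Fintype β]
    [DecidableEq β] (p : ℕ) (hc : Fintype.card α = p * Fintype.card β) :
    Nat.card {g : α → β // ∀ b, letterCount g b = p} * p.factorial ^ Fintype.card β ≤
      (p * Fintype.card β).factorial := by
  classical
  let Φ : (Σ g : {g : α → β // ∀ b, letterCount g b = p}, ∀ b, {x // g.1 x = b} ≃ Fin p) →
      (α ≃ β × Fin p) := fun q => (Equiv.sigmaFiberEquiv q.1.1).symm.trans
        ((Equiv.sigmaCongrRight q.2).trans (Equiv.sigmaEquivProd β (Fin p)))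
  have hΦ : Function.Injective Φ := by
    rintro ⟨⟨g, hg⟩, σ⟩ ⟨⟨g', hg'⟩, σ'⟩ e
    have e' : ∀ x, ((g x, σ _ ⟨x, rfl⟩) : β × Fin p) = (g' x, σ' _ ⟨x, rfl⟩) :=
      fun x => DFunLike.congr_fun e x
    obtain rfl : g = g' := funext fun x => (Prod.ext_iff.1 (e' x)).1
    congr
    funext b
    ext ⟨x, rfl⟩
    exact congrArg Fin.val (Prod.ext_iff.1 (e' x)).2
  have h := Fintype.card_le_of_injective Φ hΦ
  have hcard : Fintype.card α = Fintype.card (β × Fin p) := by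
    rw [hc, Fintype.card_prod, Fintype.card_fin, mul_comm]
  rw [Fintype.card_equiv (Fintype.equivOfCardEq hcard), hc, Fintype.card_sigma] at h
  refine le_of_eq_of_le ?_ h
  rw [Nat.card_eq_fintype_card, ← card_univ, ← smul_eq_mul, ← sum_const]
  refine sum_congr rfl fun g _ => ?_
  rw [Fintype.card_pi, ← card_univ, ← prod_const]
  refine prod_congr rfl fun b _ => ?_
  have hb : Fintype.card {x // g.1 x = b} = p := (Fintype.card_subtype _).trans (g.2 b)
  rw [Fintype.card_equiv (Fintype.equivFinOfCardEq hb), hb]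

/-- Every letter that occurs does so at least `p` times, and at least `c` letters occur exactly
`p` times. -/
def HasCounts {α β : Type*} [Fintype α] [Fintype β] [DecidableEq β] (p c : ℕ) (f : α → β) : Prop :=
  (∀ b, letterCount f b = 0 ∨ p ≤ letterCount f b) ∧ c ≤ (lettersWithCount p f).card

theorem letterCount_le_card {α β : Type*} [Fintype α] [DecidableEq β] (f : α → β) (b : β) :
    letterCount f b ≤ Fintype.card α := card_filter_le _ _

theorem one_le_letterCount {α β : Type*} [Fintype α] [DecidableEq β] (f : α → β) (x : α) :
    1 ≤ letterCount f (f x) := card_pos.2 ⟨x, by simp⟩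

theorem mul_card_lettersWithCount_le {α β : Type*} [Fintype α] [Fintype β] [DecidableEq β]
    (f : α → β) (p : ℕ) : p * (lettersWithCount p f).card ≤ Fintype.card α := by
  rw [← card_preimage_lettersWithCount]
  exact card_filter_le _ _

theorem card_subtype_notMem {α : Type*} [Fintype α] [DecidableEq α] (T : Finset α) :
    Fintype.card {x // x ∉ T} = Fintype.card α - T.card := by
  rw [Fintype.card_subtype_compl, Fintype.card_coe]

/-- Weighted version of the splitting: the bound is a summand of the recursion for `Xrec`. -/
theorem two_pow_mul_card_le_of_splitting {α β : Type*} [Fintype α] [DecidableEq α] [Fintype β]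
    [DecidableEq β] (p i : ℕ) (F : Finset (α → β))
    (PG : ∀ (S : Finset β) (T : Finset α), (T → S) → Prop)
    (PH : ∀ (S : Finset β) (T : Finset α), ({x // x ∉ T} → {b // b ∉ S}) → Prop)
    (hF : ∀ f ∈ F, (lettersWithCount p f).card = i)
    (hFG : ∀ f ∈ F, ∀ (T : Finset α) (h : ∀ x, x ∈ T ↔ f x ∈ lettersWithCount p f),
      PG _ T (Subtype.map f fun x => (h x).1))
    (hFH : ∀ f ∈ F, ∀ (T : Finset α) (h : ∀ x, x ∉ T ↔ f x ∉ lettersWithCount p f),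
      PH _ T (Subtype.map f fun x => (h x).1))
    (cg : ℕ) (r X : ℝ) (hr : 0 ≤ r) (hX : 0 ≤ X)
    (hcg : (cg : ℝ) ≤ (p * i).factorial * r)
    (hg : ∀ S T, S.card = i → T.card = p * i → Nat.card {g // PG S T g} ≤ cg)
    (hh : ∀ S T, S.card = i → T.card = p * i →
      (2 : ℝ) ^ (Fintype.card α - p * i) * Nat.card {h // PH S T h} ≤ X) :
    (2 : ℝ) ^ Fintype.card α * F.card ≤ (Fintype.card β).choose i *
      (((Fintype.card α).factorial : ℝ) / ((Fintype.card α - p * i).factorial : ℝ)) *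
      (2 ^ (p * i) * r) * X := by
  by_cases hne : F.Nonempty
  swap
  · rw [not_nonempty_iff_eq_empty.1 hne, card_empty, Nat.cast_zero, mul_zero]
    positivity
  obtain ⟨f₀, hf₀⟩ := hne
  have hle : p * i ≤ Fintype.card α := hF f₀ hf₀ ▸ mul_card_lettersWithCount_le f₀ p
  have hcard := card_le_of_splitting p i F PG PH hF hFG hFH cg
    ⌊X / 2 ^ (Fintype.card α - p * i)⌋₊ hg fun S T hS hT =>
      Nat.le_floor ((le_div_iff₀' (by positivity)).2 (hh S T hS hT))
  have hfl : (⌊X / 2 ^ (Fintype.card α - p * i)⌋₊ : ℝ) ≤ X / 2 ^ (Fintype.card α - p * i) :=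
    Nat.floor_le (by positivity)
  have hcard' := (Nat.cast_le (α := ℝ)).2 hcard
  push_cast at hcard'
  rw [Nat.cast_choose ℝ hle] at hcard'
  calc (2 : ℝ) ^ Fintype.card α * F.card
      ≤ 2 ^ Fintype.card α * ((Fintype.card β).choose i *
          ((Fintype.card α).factorial / ((p * i).factorial * (Fintype.card α - p * i).factorial)) *
          (((p * i).factorial * r) * (X / 2 ^ (Fintype.card α - p * i)))) := by
        gcongr
        exact hcard'.trans (by gcongr)
    _ = _ := by
        have h2 : (2 : ℝ) ^ Fintype.card α = 2 ^ (p * i) * 2 ^ (Fintype.card α - p * i) := by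
          rw [← pow_add, Nat.add_sub_cancel' hle]
        rw [h2]
        field_simp

theorem Xrec_nonneg (p c l d : ℕ) : 0 ≤ Xrec p c l d := by
  induction p, c, l, d using Xrec.induct with
  | case1 p c l d h => rw [Xrec, if_pos h]; exact zero_le_one
  | case2 p c l d h h' => rw [Xrec, if_neg h, dif_pos h']
  | case3 p c l d h h' ih =>
    rw [Xrec, if_neg h, dif_neg h']
    exact sum_nonneg fun i _ => mul_nonneg (by positivity) (ih i)

/-- The recursion bounds the number of words, weighted by the number of sign choices. -/
theorem two_pow_mul_card_hasCounts_le (p c : ℕ) (hp : 1 ≤ p) (α β : Type) [Fintype α]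
    [Fintype β] [DecidableEq β] :
    (2 : ℝ) ^ Fintype.card α * Nat.card {f : α → β // HasCounts p c f} ≤
      Xrec p c (Fintype.card α) (Fintype.card β) := by
  classical
  induction hk : Fintype.card α + 1 - p using Nat.strong_induction_on generalizing p c α β with
  | _ k ih =>
  rw [Xrec]
  split_ifs with h0 hpl
  · have := Fintype.card_eq_zero_iff.1 h0.2
    rw [h0.2, pow_zero, one_mul]
    exact_mod_cast Finite.card_le_one_iff_subsingleton.2 inferInstance
  · rw [Nat.card_eq_zero.2 (Or.inl ⟨?_⟩), Nat.cast_zero, mul_zero]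
    rintro ⟨f, hf, hfc⟩
    have hzero : ∀ b, letterCount f b = 0 := fun b =>
      (hf b).resolve_right fun h => absurd (h.trans (letterCount_le_card f b)) (by omega)
    have hc : c = 0 := by
      refine Nat.le_zero.1 (hfc.trans (le_of_eq ?_))
      rw [card_eq_zero, lettersWithCount, filter_eq_empty_iff]
      intro b _
      rw [hzero]
      omega
    refine h0 ⟨hc, Fintype.card_eq_zero_iff.2 ⟨fun x => ?_⟩⟩
    have := one_le_letterCount f x
    rw [hzero] at this
    omega
  · let F : ℕ → Finset (α → β) := fun i =>
      univ.filter fun f => HasCounts p c f ∧ (lettersWithCount p f).card = i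
    have hsum : Nat.card {f : α → β // HasCounts p c f} ≤
        ∑ i ∈ Icc c (Fintype.card α / p), (F i).card := by
      rw [Nat.card_eq_fintype_card, Fintype.card_subtype,
        card_eq_sum_card_fiberwise (f := fun f => (lettersWithCount p f).card)
          (t := Icc c (Fintype.card α / p))]
      · exact sum_le_sum fun i _ => by rw [filter_filter]
      · intro f hf
        have hf := (mem_filter.1 (mem_coe.1 hf)).2
        refine mem_coe.2 (mem_Icc.2 ⟨hf.2, (Nat.le_div_iff_mul_le hp).2 ?_⟩)
        rw [mul_comm]
        exact mul_card_lettersWithCount_le f p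
    refine (mul_le_mul_of_nonneg_left (Nat.cast_le.2 hsum) (by positivity)).trans ?_
    rw [Nat.cast_sum, mul_sum]
    refine sum_le_sum fun i hi => ?_
    have hfact : (0 : ℝ) < (p.factorial : ℝ) := by exact_mod_cast p.factorial_pos
    refine (two_pow_mul_card_le_of_splitting p i (F i)
      (fun S T g => ∀ b, letterCount g b = p) (fun S T h => HasCounts (p + 1) 0 h)
      (fun f hf => (mem_filter.1 hf).2.2) ?_ ?_
      ((p * i).factorial / p.factorial ^ i) (1 / (p.factorial : ℝ) ^ i)
      (Xrec (p + 1) 0 (Fintype.card α - p * i) (Fintype.card β - i)) (by positivity)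
      (Xrec_nonneg _ _ _ _) ?_ ?_ ?_).trans (le_of_eq ?_)
    · intro f hf T h b
      rw [letterCount_subtypeMap f (· ∈ T) (· ∈ lettersWithCount p f) h b]
      exact (mem_filter.1 b.2).2
    · intro f hf T h
      refine ⟨fun b => ?_, Nat.zero_le _⟩
      rw [letterCount_subtypeMap f (· ∉ T) (· ∉ lettersWithCount p f) h b]
      have h1 : letterCount f b.1 ≠ p := fun e => b.2 (mem_filter.2 ⟨mem_univ _, e⟩)
      have h2 := (mem_filter.1 hf).2.1.1 b.1
      omega
    · refine Nat.cast_div_le.trans (le_of_eq ?_)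
      push_cast
      ring
    · intro S T hS hT
      rw [Nat.le_div_iff_mul_le (by positivity)]
      have := card_letterCount_eq_mul_le (α := T) (β := S) p (by simp [hS, hT])
      simpa [hS] using this
    · intro S T hS hT
      have := ih _ ?_ (p + 1) 0 (by omega) {x // x ∉ T} {b // b ∉ S} rfl
      · simpa only [card_subtype_notMem, hS, hT] using this
      · rw [card_subtype_notMem, ← hk]
        omega
    · rw [div_pow, ← pow_mul]
      ring

end Counting

section Noncrossing

open Finset

/-- Ballot sequences, encoded by the set of their up-steps, are counted by Catalan numbers. -/
theorem card_le_catalan_of_ballot (i : ℕ) (𝒪 : Finset (Finset ℕ))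
    (hsub : ∀ O ∈ 𝒪, O ⊆ range (2 * i)) (hcard : ∀ O ∈ 𝒪, O.card = i)
    (hballot : ∀ O ∈ 𝒪, ∀ k ≤ 2 * i, ((range k).filter (· ∉ O)).card ≤
      ((range k).filter (· ∈ O)).card) :
    𝒪.card ≤ catalan i := by
  let step : Finset ℕ → ℕ → DyckStep := fun O j => if j ∈ O then DyckStep.U else DyckStep.D
  have hU : ∀ O k, ((List.range k).map (step O)).count DyckStep.U =
      ((range k).filter (· ∈ O)).card := by
    intro O k
    rw [List.count_eq_countP, List.countP_map, ← Nat.count_eq_card_filter_range, Nat.count]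
    refine List.countP_congr fun j _ => ?_
    by_cases hj : j ∈ O <;> simp [step, hj]
  have hD : ∀ O k, ((List.range k).map (step O)).count DyckStep.D =
      ((range k).filter (· ∉ O)).card := by
    intro O k
    rw [List.count_eq_countP, List.countP_map, ← Nat.count_eq_card_filter_range, Nat.count]
    refine List.countP_congr fun j _ => ?_
    by_cases hj : j ∈ O <;> simp [step, hj]
  have hfull : ∀ O ∈ 𝒪, ((range (2 * i)).filter (· ∈ O)).card = i := by
    intro O hO
    rw [filter_mem_eq_inter, inter_eq_right.2 (hsub O hO), hcard O hO]
  let word : 𝒪 → {w : DyckWord // w.semilength = i} := fun O =>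
    ⟨{ toList := (List.range (2 * i)).map (step O)
       count_U_eq_count_D := by
        have h := card_filter_add_card_filter_not (s := range (2 * i)) (· ∈ O.1)
        rw [card_range, hfull O.1 O.2] at h
        rw [hU, hD, hfull O.1 O.2]
        omega
       count_D_le_count_U := fun k => by
        rw [← List.map_take, List.take_range, hU, hD]
        exact hballot O.1 O.2 _ (min_le_right _ _) },
      (hU _ _).trans (hfull O.1 O.2)⟩
  have hword : Function.Injective word := by
    intro O O' e
    have e' : (List.range (2 * i)).map (step O) = (List.range (2 * i)).map (step O') :=
      congrArg (fun w => w.1.toList) e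
    have hstep := List.map_inj_left.1 e'
    refine Subtype.ext (Finset.ext fun j => ?_)
    by_cases hj : j < 2 * i
    · have := hstep j (List.mem_range.2 hj)
      by_cases h1 : j ∈ O.1 <;> by_cases h2 : j ∈ O'.1 <;> simp [step, h1, h2] at this ⊢
    · exact iff_of_false (fun h => hj (mem_range.1 (hsub _ O.2 h)))
        fun h => hj (mem_range.1 (hsub _ O'.2 h))
  have := Fintype.card_le_of_injective word hword
  rwa [Fintype.card_coe, DyckWord.card_dyckWord_semilength_eq_catalan] at this

variable {β : Type*} [DecidableEq β]

/-- The positions at which a letter occurs for the first time. -/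
def openers {L : ℕ} (g : Fin L → β) : Finset (Fin L) :=
  univ.filter fun x => ∀ y < x, g y ≠ g x

theorem openers_injOn {L : ℕ} (g : Fin L → β) : Set.InjOn g (openers g) := by
  intro x hx y hy e
  have hx := (mem_filter.1 (mem_coe.1 hx)).2
  have hy := (mem_filter.1 (mem_coe.1 hy)).2
  rcases lt_trichotomy x y with h | h | h
  · exact absurd e (hy x h)
  · exact h
  · exact absurd e.symm (hx y h)

theorem false_of_three {α : Type*} [Fintype α] [DecidableEq α] (g : α → β)
    (hg : ∀ b, letterCount g b = 2) (x y z : α) (hxy : x ≠ y) (hxz : x ≠ z) (hyz : y ≠ z)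
    (h1 : g y = g x) (h2 : g z = g x) : False := by
  have hsub : ({x, y, z} : Finset α) ⊆ univ.filter fun j => g j = g x := by
    intro j hj
    simp only [mem_insert, mem_singleton] at hj
    rcases hj with rfl | rfl | rfl <;> simp [h1, h2]
  have := card_le_card hsub
  rw [card_eq_three.2 ⟨x, y, z, hxy, hxz, hyz, rfl⟩] at this
  have h2 : _ = 2 := hg (g x)
  rw [letterCount] at h2
  omega

theorem exists_lt_of_notMem_openers {L : ℕ} {g : Fin L → β} {x : Fin L} (hx : x ∉ openers g) :
    ∃ y < x, g y = g x := by
  simpa [openers] using hx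

theorem closers_injOn {L : ℕ} (g : Fin L → β) (hg : ∀ b, letterCount g b = 2) :
    Set.InjOn g {x | x ∉ openers g} := by
  have key : ∀ x y, x ∉ openers g → x < y → g x ≠ g y := by
    intro x y hx hxy e
    obtain ⟨z, hz, ez⟩ := exists_lt_of_notMem_openers hx
    exact false_of_three g hg x y z hxy.ne hz.ne' (hz.trans hxy).ne' e.symm ez
  intro x hx y hy e
  rcases lt_trichotomy x y with h | h | h
  · exact absurd e (key x y hx h)
  · exact h
  · exact absurd e.symm (key y x hy h)

theorem card_closers_le {L : ℕ} (g : Fin L → β) (hg : ∀ b, letterCount g b = 2) (k : ℕ) :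
    (univ.filter fun x : Fin L => x.1 < k ∧ x ∉ openers g).card ≤
      (univ.filter fun x : Fin L => x.1 < k ∧ x ∈ openers g).card := by
  rw [← card_image_of_injOn (f := g) fun x hx y hy =>
    closers_injOn g hg (mem_filter.1 (mem_coe.1 hx)).2.2 (mem_filter.1 (mem_coe.1 hy)).2.2]
  refine (card_le_card ?_).trans (card_image_le (f := g))
  intro b hb
  obtain ⟨x, hx, rfl⟩ := mem_image.1 hb
  obtain ⟨hxk, hxo⟩ := (mem_filter.1 hx).2
  obtain ⟨y, hy, e⟩ := exists_lt_of_notMem_openers hxo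
  refine mem_image.2 ⟨y, mem_filter.2 ⟨mem_univ _, (Fin.lt_def.1 hy).trans hxk, ?_⟩, e⟩
  by_contra hyo
  exact hy.ne (closers_injOn g hg hyo hxo e)

theorem card_openers [Fintype β] {L : ℕ} (g : Fin L → β) (hg : ∀ b, letterCount g b = 2) :
    (openers g).card = Fintype.card β := by
  rw [← card_image_of_injOn (openers_injOn g), ← card_univ]
  congr 1
  refine eq_univ_of_forall fun b => ?_
  obtain ⟨x, y, hxy, e⟩ := exists_pair_of_letterCount_eq_two g b (hg b)
  have hm : ∀ j, g j = b ↔ j = x ∨ j = y := fun j => by simpa using Finset.ext_iff.1 e j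
  have hx := (hm x).2 (Or.inl rfl)
  refine mem_image.2 ⟨x, mem_filter.2 ⟨mem_univ _, fun z hz ez => ?_⟩, hx⟩
  rcases (hm z).1 (ez.trans hx) with rfl | rfl
  · exact lt_irrefl _ hz
  · exact lt_asymm hz hxy

/-- A noncrossing pairing is determined by its openers and the letters there. -/
theorem eq_of_openers_eq {L : ℕ} (g g' : Fin L → β) (hg : ∀ b, letterCount g b = 2)
    (hg' : ∀ b, letterCount g' b = 2) (hn : IsNoncrossing g) (hn' : IsNoncrossing g')
    (ho : openers g = openers g') (heq : ∀ x ∈ openers g, g x = g' x) : g = g' := by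
  have key : ∀ (g g' : Fin L → β), (∀ b, letterCount g b = 2) → (∀ b, letterCount g' b = 2) →
      IsNoncrossing g → ∀ x x₁ y₁ : Fin L, (∀ z < x, g z = g' z) → x₁ < y₁ → y₁ < x →
      g x₁ = g x → g' y₁ = g' x → g x = g' x := by
    intro g g' hg hg' hn x x₁ y₁ ih h1 h2 e1 e2
    have e3 : g y₁ = g' x := (ih y₁ h2).trans e2
    obtain ⟨u, v, huv, e⟩ := exists_pair_of_letterCount_eq_two g (g' x) (hg _)
    have hm : ∀ j, g j = g' x ↔ j = u ∨ j = v := fun j => by simpa using Finset.ext_iff.1 e j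
    obtain ⟨y₂, hy, e4⟩ : ∃ y₂, y₂ ≠ y₁ ∧ g y₂ = g' x := by
      rcases (hm y₁).1 e3 with rfl | rfl
      · exact ⟨v, huv.ne', (hm v).2 (Or.inr rfl)⟩
      · exact ⟨u, huv.ne, (hm u).2 (Or.inl rfl)⟩
    rcases lt_trichotomy y₂ x with h | h | h
    · exact (false_of_three g' hg' x y₁ y₂ h2.ne' h.ne' hy.symm e2 ((ih _ h).symm.trans e4)).elim
    · rw [← h, e4, h]
    · rw [← e1, hn x₁ y₁ x y₂ h1 h2 h e1.symm (e4.trans e3.symm), e3]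
  funext x
  induction x using WellFoundedLT.induction with
  | _ x ih =>
  by_cases hx : x ∈ openers g
  · exact heq x hx
  obtain ⟨x₁, hx₁, e₁⟩ := exists_lt_of_notMem_openers hx
  obtain ⟨y₁, hy₁, e₂⟩ := exists_lt_of_notMem_openers (ho ▸ hx)
  rcases lt_trichotomy x₁ y₁ with h | h | h
  · exact key g g' hg hg' hn x x₁ y₁ ih h hy₁ e₁ e₂
  · rw [← e₁, ← e₂, ← h, ih _ hx₁]
  · exact (key g' g hg' hg hn' x y₁ x₁ (fun z hz => (ih z hz).symm) h hx₁ e₂ e₁).symm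

theorem card_noncrossing_fin_le [Fintype β] :
    Nat.card {g : Fin (2 * Fintype.card β) → β // (∀ b, letterCount g b = 2) ∧ IsNoncrossing g} ≤
      (Fintype.card β).factorial * catalan (Fintype.card β) := by
  classical
  rw [Nat.card_eq_fintype_card, Fintype.card_subtype]
  set F := univ.filter fun g : Fin (2 * Fintype.card β) → β =>
    (∀ b, letterCount g b = 2) ∧ IsNoncrossing g with hF
  have hmem : ∀ g ∈ F, (∀ b, letterCount g b = 2) ∧ IsNoncrossing g := fun g hg =>
    (mem_filter.1 hg).2
  refine (card_le_mul_card_image (f := openers) F (Fintype.card β).factorial ?_).trans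
    (Nat.mul_le_mul_left _ ?_)
  · intro O hO
    obtain ⟨g₀, hg₀, hO⟩ := mem_image.1 hO
    let Φ : {g // g ∈ F.filter fun g => openers g = O} → (O ↪ β) := fun g =>
      ⟨fun x => g.1 x, fun x y e => Subtype.ext (openers_injOn g.1
        (by rw [(mem_filter.1 g.2).2]; exact x.2) (by rw [(mem_filter.1 g.2).2]; exact y.2) e)⟩
    have hΦ : Function.Injective Φ := by
      rintro ⟨g, hg⟩ ⟨g', hg'⟩ e
      obtain ⟨h1, rfl⟩ := mem_filter.1 hg
      obtain ⟨h2, e2⟩ := mem_filter.1 hg'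
      exact Subtype.ext (eq_of_openers_eq g g' (hmem _ h1).1 (hmem _ h2).1 (hmem _ h1).2
        (hmem _ h2).2 e2.symm fun x hx => DFunLike.congr_fun e ⟨x, hx⟩)
    have := Fintype.card_le_of_injective Φ hΦ
    rwa [Fintype.card_coe, Fintype.card_embedding_eq, Fintype.card_coe, ← hO,
      card_openers g₀ (hmem _ hg₀).1, Nat.descFactorial_self, hO] at this
  · rw [← card_image_of_injective (F.image openers) (map_injective Fin.valEmbedding)]
    have hcond : ∀ (g : Fin (2 * Fintype.card β) → β) (P : Prop → Prop), ∀ k ≤ 2 * Fintype.card β,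
        ((range k).filter fun j => P (j ∈ (openers g).map Fin.valEmbedding)).card =
          (univ.filter fun x : Fin (2 * Fintype.card β) => x.1 < k ∧ P (x ∈ openers g)).card := by
      intro g P k hk
      rw [← card_map Fin.valEmbedding]
      congr 1
      ext j
      simp only [mem_filter, mem_range, mem_map, mem_univ, true_and, Fin.valEmbedding_apply]
      constructor
      · rintro ⟨hj, hP⟩
        refine ⟨⟨j, hj.trans_le hk⟩, ⟨hj, ?_⟩, rfl⟩
        convert hP using 1
        exact ⟨fun h => ⟨_, h, rfl⟩, fun ⟨x, h, e⟩ => by subst e; exact h⟩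
      · rintro ⟨x, ⟨hx, hP⟩, rfl⟩
        refine ⟨hx, ?_⟩
        convert hP using 1
        exact ⟨fun ⟨y, h, e⟩ => Fin.ext e ▸ h, fun h => ⟨_, h, rfl⟩⟩
    apply card_le_catalan_of_ballot
    all_goals
      intro O hO
      obtain ⟨O', hO', rfl⟩ := mem_image.1 hO
      obtain ⟨g, hg, rfl⟩ := mem_image.1 hO'
    · intro j hj
      obtain ⟨x, -, rfl⟩ := mem_map.1 hj
      exact mem_range.2 x.2
    · rw [card_map, card_openers g (hmem _ hg).1]
    · intro k hk
      have h1 := hcond g Not k hk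
      have h2 := hcond g id k hk
      simp only [id] at h2
      convert card_closers_le g (hmem _ hg).1 k using 1
      convert h1

theorem factorial_mul_catalan_mul (i : ℕ) :
    i.factorial * catalan i * (i + 1).factorial = (2 * i).factorial := by
  have h1 := succ_mul_catalan_eq_centralBinom i
  have h2 := Nat.choose_mul_factorial_mul_factorial (show i ≤ 2 * i by omega)
  rw [← Nat.centralBinom_eq_two_mul_choose, ← h1, show 2 * i - i = i by omega] at h2
  rw [← h2, Nat.factorial_succ]
  ring

/-- Noncrossing pairings with labelled blocks. -/
theorem card_noncrossing_mul_le {α : Type*} [Fintype α] [LinearOrder α] [Fintype β]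
    (hc : Fintype.card α = 2 * Fintype.card β) :
    Nat.card {g : α → β // (∀ b, letterCount g b = 2) ∧ IsNoncrossing g} *
      (Fintype.card β + 1).factorial ≤ (2 * Fintype.card β).factorial := by
  let e : Fin (2 * Fintype.card β) ≃o α := Fintype.orderIsoFinOfCardEq α hc
  rw [← factorial_mul_catalan_mul]
  refine Nat.mul_le_mul_right _ (le_trans ?_ card_noncrossing_fin_le)
  refine Nat.card_le_card_of_injective (fun g => ⟨g.1 ∘ e, fun b => ?_, ?_⟩) ?_
  · refine Eq.trans ?_ (g.2.1 b)
    refine card_bij (fun x _ => e x) (fun x hx => by simpa using hx)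
      (fun x _ y _ h => e.injective h) fun y hy => ⟨e.symm y, by simpa using hy, by simp⟩
  · intro x y x' y' h1 h2 h3 e1 e2
    exact g.2.2 _ _ _ _ (e.strictMono h1) (e.strictMono h2) (e.strictMono h3) e1 e2
  · intro g g' h
    have h' : g.1 ∘ e = g'.1 ∘ e := congrArg Subtype.val h
    exact Subtype.ext (funext fun x => by simpa using congrFun h' (e.symm x))

end Noncrossing

section WordSums

open Finset

variable {β : Type} [Fintype β] [DecidableEq β] {L : ℕ}

/-- Each letter occurs `0`, `2` or at least `q` times, at least `c` letters occur `q` times, and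
exactly `i` letters occur twice. -/
def HasPairs (q c i : ℕ) (f : Fin L → β) : Prop :=
  (∀ b, letterCount f b = 0 ∨ letterCount f b = 2 ∨ q ≤ letterCount f b) ∧
    c ≤ (lettersWithCount q f).card ∧ (lettersWithCount 2 f).card = i

/-- The letters occurring twice do not interleave. -/
def PairsNoncrossing (f : Fin L → β) : Prop :=
  ∀ x y x' y' : Fin L, x < y → y < x' → x' < y' → f x' = f x → f y' = f y →
    letterCount f (f x) = 2 → letterCount f (f y) = 2 → f x = f y

theorem HasPairs.hasCounts_subtypeMap {q c i : ℕ} (hq : 3 ≤ q) {f : Fin L → β}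
    (hf : HasPairs q c i f) (T : Finset (Fin L)) (h : ∀ x, x ∉ T ↔ f x ∉ lettersWithCount 2 f) :
    HasCounts q c (Subtype.map f fun x => (h x).1 :
      {x // x ∉ T} → {b // b ∉ lettersWithCount 2 f}) := by
  have hcount := letterCount_subtypeMap f (· ∉ T) (· ∉ lettersWithCount 2 f) h
  refine ⟨fun b => ?_, hf.2.1.trans ?_⟩
  · rw [hcount b]
    have h1 : letterCount f b.1 ≠ 2 := fun e => b.2 (mem_filter.2 ⟨mem_univ _, e⟩)
    have h2 := hf.1 b.1
    omega
  · rw [← card_map (Function.Embedding.subtype _)]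
    refine card_le_card fun b hb => ?_
    have hb := (mem_filter.1 hb).2
    have hb' : b ∉ lettersWithCount 2 f := fun h' => by
      have := (mem_filter.1 h').2
      omega
    exact mem_map.2 ⟨⟨b, hb'⟩, mem_filter.2 ⟨mem_univ _, (hcount _).trans hb⟩, rfl⟩

theorem two_pow_mul_card_hasPairs_le (q c i : ℕ) (hq : 3 ≤ q) (F : Finset (Fin L → β))
    (hF : ∀ f ∈ F, HasPairs q c i f) :
    (2 : ℝ) ^ L * F.card ≤ (Fintype.card β).choose i *
      ((L.factorial : ℝ) / ((L - 2 * i).factorial : ℝ)) * 2 ^ i *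
      Xrec q c (L - 2 * i) (Fintype.card β - i) := by
  have := two_pow_mul_card_le_of_splitting 2 i F
      (fun S T g => ∀ b, letterCount g b = 2) (fun S T h => HasCounts q c h)
      (fun f hf => (hF f hf).2.2) ?_ (fun f hf T h => (hF f hf).hasCounts_subtypeMap hq T h)
      ((2 * i).factorial / Nat.factorial 2 ^ i) (1 / (2 : ℝ) ^ i)
      (Xrec q c (L - 2 * i) (Fintype.card β - i)) (by positivity)
      (Xrec_nonneg _ _ _ _) ?_ ?_ ?_
  · rw [Fintype.card_fin] at this
    refine this.trans (le_of_eq ?_)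
    rw [pow_mul]
    have : ((2 : ℝ) ^ 2) ^ i * (1 / 2 ^ i) = 2 ^ i := by
      rw [mul_one_div, ← div_pow]; norm_num
    rw [this]
  · intro f hf T h b
    rw [letterCount_subtypeMap f (· ∈ T) (· ∈ lettersWithCount 2 f) h b]
    exact (mem_filter.1 b.2).2
  · refine Nat.cast_div_le.trans (le_of_eq ?_)
    push_cast
    ring
  · intro S T hS hT
    rw [Nat.le_div_iff_mul_le (by positivity)]
    have := card_letterCount_eq_mul_le (α := T) (β := S) 2 (by simp [hS, hT])
    simpa [hS] using this
  · intro S T hS hT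
    have := two_pow_mul_card_hasCounts_le q c (by omega) {x // x ∉ T} {b // b ∉ S}
    simpa only [card_subtype_notMem, hS, hT, Fintype.card_fin] using this

theorem two_pow_mul_card_noncrossing_le (q c i : ℕ) (hq : 3 ≤ q) (F : Finset (Fin L → β))
    (hF : ∀ f ∈ F, HasPairs q c i f ∧ PairsNoncrossing f) :
    (2 : ℝ) ^ L * F.card ≤ (Fintype.card β).choose i *
      ((L.factorial : ℝ) / ((L - 2 * i).factorial : ℝ)) *
      (2 ^ (2 * i) * (1 / ((i + 1).factorial : ℝ))) *
      Xrec q c (L - 2 * i) (Fintype.card β - i) := by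
  have := two_pow_mul_card_le_of_splitting 2 i F
      (fun S T g => (∀ b, letterCount g b = 2) ∧ IsNoncrossing g) (fun S T h => HasCounts q c h)
      (fun f hf => (hF f hf).1.2.2) ?_ (fun f hf T h => (hF f hf).1.hasCounts_subtypeMap hq T h)
      ((2 * i).factorial / (i + 1).factorial) (1 / ((i + 1).factorial : ℝ))
      (Xrec q c (L - 2 * i) (Fintype.card β - i)) (by positivity)
      (Xrec_nonneg _ _ _ _) ?_ ?_ ?_
  · rwa [Fintype.card_fin] at this
  · intro f hf T h
    refine ⟨fun b => ?_, ?_⟩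
    · rw [letterCount_subtypeMap f (· ∈ T) (· ∈ lettersWithCount 2 f) h b]
      exact (mem_filter.1 b.2).2
    · intro x y x' y' h1 h2 h3 e1 e2
      exact Subtype.ext ((hF f hf).2 x y x' y' h1 h2 h3 (congrArg Subtype.val e1)
        (congrArg Subtype.val e2) (mem_filter.1 ((h x).1 x.2)).2 (mem_filter.1 ((h y).1 y.2)).2)
  · refine Nat.cast_div_le.trans (le_of_eq ?_)
    ring
  · intro S T hS hT
    rw [Nat.le_div_iff_mul_le (by positivity)]
    have := card_noncrossing_mul_le (α := T) (β := S) (by simp [hS, hT])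
    simpa [hS] using this
  · intro S T hS hT
    have := two_pow_mul_card_hasCounts_le q c (by omega) {x // x ∉ T} {b // b ∉ S}
    simpa only [card_subtype_notMem, hS, hT, Fintype.card_fin] using this

open Classical in
/-- The weight assigned to a word without single letters by the bounds on fixed points. -/
noncomputable def pairWeight (m q c : ℕ) (Q : ℝ) (f : Fin L → β) : ℝ :=
  (if HasPairs q c 0 f then 1 else 0) * Q + ∑ i ∈ Icc 1 m,
    ((if HasPairs q c i f then 1 else 0) * (2 * (1 - 1 / 2 ^ i) + 1 / 2 ^ i) +
      (if HasPairs q c i f ∧ PairsNoncrossing f then 1 else 0) * (Q * (1 / 2 ^ i)))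

theorem one_div_two_pow_le_one (i : ℕ) : (1 : ℝ) / 2 ^ i ≤ 1 := by
  rw [div_le_one (by positivity)]
  exact one_le_pow₀ one_le_two

open Classical in
theorem pairWeight_summand_nonneg (q c i : ℕ) (Q : ℝ) (hQ : 0 ≤ Q) (f : Fin L → β) :
    0 ≤ (if HasPairs q c i f then (1 : ℝ) else 0) * (2 * (1 - 1 / 2 ^ i) + 1 / 2 ^ i) +
      (if HasPairs q c i f ∧ PairsNoncrossing f then 1 else 0) * (Q * (1 / 2 ^ i)) := by
  have h2 := one_div_two_pow_le_one i
  have h3 : (0 : ℝ) ≤ 1 / 2 ^ i := by positivity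
  have h4 : (0 : ℝ) ≤ 2 * (1 - 1 / 2 ^ i) + 1 / 2 ^ i := by linarith
  positivity

theorem pairWeight_nonneg (m q c : ℕ) (Q : ℝ) (hQ : 0 ≤ Q) (f : Fin L → β) :
    0 ≤ pairWeight m q c Q f :=
  add_nonneg (mul_nonneg (by split_ifs <;> norm_num) hQ)
    (sum_nonneg fun i _ => pairWeight_summand_nonneg q c i Q hQ f)

theorem sum_pairWeight_le (m q c : ℕ) (hq : 3 ≤ q) (Q : ℝ) (hQ : 0 ≤ Q) :
    (2 : ℝ) ^ L * ∑ f : Fin L → β, pairWeight m q c Q f ≤ Xrec q c L (Fintype.card β) * Q +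
      ∑ i ∈ Icc 1 m, (Fintype.card β).choose i *
        ((L.factorial : ℝ) / ((L - 2 * i).factorial : ℝ)) *
        ((2 ^ i - 1) * 2 + 1 + 2 ^ i / ((i + 1).factorial : ℝ) * Q) *
        Xrec q c (L - 2 * i) (Fintype.card β - i) := by
  classical
  unfold pairWeight
  rw [sum_add_distrib, sum_comm, mul_add, mul_sum (Icc 1 m)]
  refine add_le_add ?_ (sum_le_sum fun i _ => ?_)
  · rw [← sum_mul, ← mul_assoc, sum_boole]
    refine mul_le_mul_of_nonneg_right ?_ hQ
    refine (two_pow_mul_card_hasPairs_le q c 0 hq _ fun f hf => (mem_filter.1 hf).2).trans ?_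
    have : (L.factorial : ℝ) ≠ 0 := by positivity
    simp [this]
  · rw [sum_add_distrib, ← sum_mul, ← sum_mul, sum_boole, sum_boole, mul_add, ← mul_assoc,
      ← mul_assoc]
    have h1 := two_pow_mul_card_hasPairs_le q c i hq
      (univ.filter fun f : Fin L → β => HasPairs q c i f) fun f hf => (mem_filter.1 hf).2
    have h2 := two_pow_mul_card_noncrossing_le q c i hq
      (univ.filter fun f : Fin L → β => HasPairs q c i f ∧ PairsNoncrossing f)
      fun f hf => (mem_filter.1 hf).2
    have h3 := one_div_two_pow_le_one i
    have h4 : (0 : ℝ) ≤ 1 / 2 ^ i := by positivity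
    refine (add_le_add (mul_le_mul_of_nonneg_right h1 (by linarith))
      (mul_le_mul_of_nonneg_right h2 (mul_nonneg hQ h4))).trans (le_of_eq ?_)
    have h5 : (2 : ℝ) ^ (2 * i) = 2 ^ i * 2 ^ i := by rw [two_mul, pow_add]
    rw [h5]
    field_simp

variable {G Ω : Type*} [Group G] [Fintype G] [Fintype Ω] [DecidableEq Ω] [MulAction G Ω]

namespace TransitivityBounds

variable {t : Ω → Ω → Ω} (H : TransitivityBounds G Ω t)
include H

theorem sum_totalFix_le_pairWeight (m q c i : ℕ) (hi : i ≤ m) (Q : ℝ) (hQ : 0 ≤ Q)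
    (f : Fin L → β) (hf : HasPairs q c i f)
    (hfix : ∀ ε, totalFix G Ω f ε ≤ Q * (Fintype.card G : ℝ) ^ Fintype.card β) :
    ∑ ε, totalFix G Ω f ε ≤ (Fintype.card G : ℝ) ^ Fintype.card β * 2 ^ L *
      pairWeight m q c Q f := by
  classical
  have hc : (lettersWithCount 2 f).card = i := hf.2.2
  rcases Nat.eq_zero_or_pos i with rfl | hpos
  · refine (H.sum_totalFix_le_of_le f Q hfix).trans (mul_le_mul_of_nonneg_left ?_ (by positivity))
    rw [hc, pairWeight, if_pos hf]
    have := sum_nonneg fun i (_ : i ∈ Icc 1 m) => pairWeight_summand_nonneg q c i Q hQ f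
    norm_num at this ⊢
    linarith
  · have hle := single_le_sum (fun i _ => pairWeight_summand_nonneg q c i Q hQ f)
      (mem_Icc.2 ⟨hpos, hi⟩)
    rw [if_pos hf] at hle
    have hw : (1 : ℝ) * (2 * (1 - 1 / 2 ^ i) + 1 / 2 ^ i) +
        (if HasPairs q c i f ∧ PairsNoncrossing f then 1 else 0) * (Q * (1 / 2 ^ i)) ≤
        pairWeight m q c Q f :=
      hle.trans (le_add_of_nonneg_left (mul_nonneg (by split_ifs <;> norm_num) hQ))
    have h4 : (0 : ℝ) ≤ 1 / 2 ^ i := by positivity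
    by_cases hn : PairsNoncrossing f
    · rw [if_pos ⟨hf, hn⟩] at hw
      refine (H.sum_totalFix_le_of_le f Q hfix).trans (mul_le_mul_of_nonneg_left ?_ (by positivity))
      rw [hc]
      linarith
    · unfold PairsNoncrossing at hn
      push Not at hn
      obtain ⟨x, y, x', y', h1, h2, h3, e1, e2, c1, c2, hne⟩ := hn
      refine (H.sum_totalFix_le_of_crossing f x y x' y' h1 h2 h3 hne e1 e2 c1 c2).trans
        (mul_le_mul_of_nonneg_left ?_ (by positivity))
      rw [hc]
      refine le_trans ?_ hw
      rw [one_mul]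
      exact le_add_of_nonneg_right (mul_nonneg (by split_ifs <;> norm_num) (mul_nonneg hQ h4))

/-- The total number of fixed points over all words of length `2 * m`. -/
theorem sum_sum_totalFix_le (m : ℕ) :
    ∑ f : Fin (2 * m) → β, ∑ ε, totalFix G Ω f ε ≤ (Fintype.card G : ℝ) ^ Fintype.card β *
      (Xrec 1 1 (2 * m) (Fintype.card β) +
        2 ^ (2 * m) * ∑ f : Fin (2 * m) → β, pairWeight m 3 1 5 f +
        2 ^ (2 * m) * ∑ f : Fin (2 * m) → β, pairWeight m 4 0 (Fintype.card Ω) f) := by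
  classical
  have hpt : ∀ f : Fin (2 * m) → β, ∑ ε, totalFix G Ω f ε ≤
      (Fintype.card G : ℝ) ^ Fintype.card β * 2 ^ (2 * m) *
        ((if HasCounts 1 1 f then 1 else 0) + pairWeight m 3 1 5 f +
          pairWeight m 4 0 (Fintype.card Ω) f) := by
    intro f
    have h3 := pairWeight_nonneg m 3 1 5 (by norm_num) f
    have h4 := pairWeight_nonneg m 4 0 (Fintype.card Ω) (by positivity) f
    have h1 : (0 : ℝ) ≤ if HasCounts 1 1 f then 1 else 0 := by split_ifs <;> norm_num
    have hi : (lettersWithCount 2 f).card ≤ m := by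
      have := mul_card_lettersWithCount_le f 2
      rw [Fintype.card_fin] at this
      omega
    by_cases hone : ∃ b, letterCount f b = 1
    · obtain ⟨b, hb⟩ := hone
      refine (sum_le_sum fun ε _ => H.totalFix_le_of_letterCount_eq_one f ε b hb).trans ?_
      have hc : HasCounts 1 1 f := ⟨fun b => by omega,
        Finset.card_pos.2 ⟨b, mem_filter.2 ⟨mem_univ _, hb⟩⟩⟩
      rw [if_pos hc, sum_const, card_univ, Fintype.card_pi, nsmul_eq_mul]
      simp only [ZMod.card, prod_const, card_univ, Fintype.card_fin]
      push_cast
      rw [one_mul, mul_comm]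
      exact le_mul_of_one_le_right (by positivity) (by linarith)
    · push Not at hone
      by_cases hthree : ∃ b, letterCount f b = 3
      · obtain ⟨b, hb⟩ := hthree
        refine (H.sum_totalFix_le_pairWeight m 3 1 _ hi 5 (by norm_num) f
          ⟨fun b => ?_, Finset.card_pos.2 ⟨b, mem_filter.2 ⟨mem_univ _, hb⟩⟩, rfl⟩
          fun ε => H.totalFix_le_of_letterCount_eq_three f ε b hb).trans
          (mul_le_mul_of_nonneg_left (by linarith) (by positivity))
        have := hone b
        omega
      · push Not at hthree
        refine (H.sum_totalFix_le_pairWeight m 4 0 _ hi _ (by positivity) f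
          ⟨fun b => ?_, Nat.zero_le _, rfl⟩ fun ε => totalFix_le_card f ε).trans
          (mul_le_mul_of_nonneg_left (by linarith) (by positivity))
        have := hone b
        have := hthree b
        omega
  refine (sum_le_sum fun f _ => hpt f).trans ?_
  rw [← mul_sum, sum_add_distrib, sum_add_distrib, sum_boole, mul_assoc]
  refine mul_le_mul_of_nonneg_left ?_ (pow_nonneg (Nat.cast_nonneg _) _)
  have := two_pow_mul_card_hasCounts_le 1 1 le_rfl (Fin (2 * m)) β
  rw [Fintype.card_fin, Nat.card_eq_fintype_card, Fintype.card_subtype] at this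
  linarith

end TransitivityBounds

end WordSums

section Trace

open Finset

/-- The permutation matrix of a group element. -/
def permMatrix {G : Type*} (Ω : Type*) [DecidableEq Ω] [SMul G Ω] (g : G) : Matrix Ω Ω ℝ :=
  Matrix.of fun x y => if g • y = x then 1 else 0

variable {G Ω : Type*} [Group G] [DecidableEq Ω] [MulAction G Ω]

theorem permMatrix_one : permMatrix Ω (1 : G) = 1 := by
  ext x y
  simp [permMatrix, Matrix.one_apply, eq_comm]

variable [Fintype Ω]

theorem permMatrix_mul (g h : G) : permMatrix Ω (g * h) = permMatrix Ω g * permMatrix Ω h := by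
  ext x y
  simp [permMatrix, Matrix.mul_apply, mul_smul]

theorem trace_permMatrix (g : G) : (permMatrix Ω g).trace = fixCount Ω g := rfl

theorem permMatrix_wordEval {β : Type*} (s : β → G) (w : List (β × ZMod 2)) :
    permMatrix Ω (wordEval s w) = (w.map fun p => permMatrix Ω (signed p.2 (s p.1))).prod := by
  induction w with
  | nil => simp [wordEval, permMatrix_one]
  | cons p w ih => rw [wordEval_cons, permMatrix_mul, ih, List.map_cons, List.prod_cons]

theorem sum_pow_eq_sum_prod_ofFn {R ι : Type*} [Semiring R] [Fintype ι] (A : ι → R) (L : ℕ) :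
    (∑ q, A q) ^ L = ∑ w : Fin L → ι, (List.ofFn fun j => A (w j)).prod := by
  induction L with
  | zero => simp
  | succ L ih =>
    rw [pow_succ', ih, sum_mul_sum, ← (Fin.consEquiv fun _ : Fin (L + 1) => ι).sum_comp,
      Fintype.sum_prod_type]
    simp [Fin.consEquiv, List.ofFn_succ]

theorem sum_trace_pow [Fintype G] {β : Type*} [Fintype β] [DecidableEq β] (c : ℝ) (L : ℕ) :
    ∑ s : β → G, ((c • ∑ q : β × ZMod 2, permMatrix Ω (signed q.2 (s q.1))) ^ L).trace =
      c ^ L * ∑ f : Fin L → β, ∑ ε, totalFix G Ω f ε := by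
  simp only [smul_pow, Matrix.trace_smul, sum_pow_eq_sum_prod_ofFn, Matrix.trace_sum, smul_eq_mul]
  rw [← mul_sum, sum_comm, ← (Equiv.arrowProdEquivProdArrow (Fin L) (fun _ => β)
    (fun _ => ZMod 2)).symm.sum_comp, Fintype.sum_prod_type]
  refine congrArg _ (sum_congr rfl fun f _ => sum_congr rfl fun ε _ => sum_congr rfl fun s _ => ?_)
  rw [← trace_permMatrix, permMatrix_wordEval, signedWord, List.map_ofFn]
  rfl

theorem trace_pow_eq_sum_eigenvalues_pow {n : Type*} [Fintype n] [DecidableEq n]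
    {A : Matrix n n ℝ} (hA : A.IsHermitian) (L : ℕ) :
    (A ^ L).trace = ∑ i, hA.eigenvalues i ^ L := by
  conv_lhs => rw [hA.spectral_theorem, ← map_pow, Matrix.diagonal_pow]
  simp [Unitary.conjStarAlgAut_apply, Matrix.trace_mul_cycle]

end Trace

section Schreier

open Finset

theorem schreier_eq_smul_sum_permMatrix {k d : ℕ}
    (s : Fin d → GL (Fin k) (ZMod 2))
    (A : Matrix {v : Fin k → ZMod 2 // v ≠ 0} {v : Fin k → ZMod 2 // v ≠ 0} ℝ)
    (hA : ∀ x y, A x y =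
      (((univ.filter fun i : Fin d =>
          (s i : Matrix (Fin k) (Fin k) (ZMod 2)).mulVec x.val = y.val).card : ℝ)
        + ((univ.filter fun i : Fin d =>
          ((s i)⁻¹ : Matrix (Fin k) (Fin k) (ZMod 2)).mulVec x.val = y.val).card : ℝ))
        / (2 * d)) :
    A = (1 / (2 * d : ℝ)) • ∑ q : Fin d × ZMod 2,
      permMatrix {v : Fin k → ZMod 2 // v ≠ 0} (signed q.2 (s q.1)) := by
  ext x y
  have h1 : ∀ i, (s i : Matrix (Fin k) (Fin k) (ZMod 2)).mulVec x.val = y.val ↔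
      (s i)⁻¹ • y = x := fun i => by
    rw [inv_smul_eq_iff, eq_comm, Subtype.ext_iff, gl_smul_val]
  have h2 : ∀ i, ((s i)⁻¹ : Matrix (Fin k) (Fin k) (ZMod 2)).mulVec x.val = y.val ↔
      s i • y = x := fun i => by
    rw [← Matrix.coe_units_inv, ← gl_smul_val, ← Subtype.ext_iff, inv_smul_eq_iff, eq_comm]
  have hz : ∀ φ : ZMod 2 → ℝ, ∑ e, φ e = φ 0 + φ 1 := fun φ => Fin.sum_univ_two φ
  rw [hA]
  simp only [h1, h2, ← sum_boole]
  rw [Matrix.smul_apply, Matrix.sum_apply, Fintype.sum_prod_type, smul_eq_mul]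
  simp only [hz, permMatrix, signed, Matrix.of_apply, sum_add_distrib, if_true, one_ne_zero,
    if_false]
  ring

theorem one_add_abs_pow_le_trace_pow {ι : Type*} [Fintype ι] [DecidableEq ι] {A : Matrix ι ι ℝ}
    (hA : A.IsHermitian) {n : ℕ} (e : Fin n ≃ ι) {ν : Fin n → ℝ}
    (hν : ∀ i, ν i = hA.eigenvalues (e i)) {a b : Fin n} (hab : a ≠ b) (ha : ν a = 1) (m : ℕ) :
    1 + |ν b| ^ (2 * m) ≤ (A ^ (2 * m)).trace := by
  have heven : ∀ i, 0 ≤ ν i ^ (2 * m) := fun i => (even_two_mul m).pow_nonneg _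
  rw [trace_pow_eq_sum_eigenvalues_pow hA, ← e.sum_comp, (even_two_mul m).pow_abs]
  simp only [← hν]
  calc 1 + ν b ^ (2 * m) = ∑ i ∈ {a, b}, ν i ^ (2 * m) := by rw [sum_pair hab, ha, one_pow]
    _ ≤ _ := sum_le_sum_of_subset_of_nonneg (subset_univ _) fun i _ _ => heven i

theorem mean_le_rpow_of_sum_pow_le {ι : Type*} [Fintype ι] [Nonempty ι] {f : ι → ℝ}
    (hf : ∀ i, 0 ≤ f i) {m : ℕ} (hm : 0 < m) {B : ℝ}
    (h : ∑ i, (1 + f i ^ (2 * m)) ≤ Fintype.card ι * B) :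
    (∑ i, f i) / Fintype.card ι ≤ (B - 1) ^ ((1 : ℝ) / (2 * m)) := by
  have hN : (0 : ℝ) < Fintype.card ι := by exact_mod_cast Fintype.card_pos
  have hpow : ((∑ i, f i) / Fintype.card ι) ^ (2 * m) ≤ B - 1 := by
    have hjen := Real.pow_arith_mean_le_arith_mean_pow univ (fun _ : ι => (Fintype.card ι : ℝ)⁻¹) f
      (fun _ _ => by positivity) (by simp [hN.ne']) (fun i _ => hf i) (2 * m)
    rw [← mul_sum, ← mul_sum, inv_mul_eq_div, inv_mul_eq_div] at hjen
    refine hjen.trans ?_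
    rw [sum_add_distrib, sum_const, card_univ, nsmul_eq_mul, mul_one] at h
    rw [div_le_iff₀' hN]
    linarith
  have h0 : 0 ≤ (∑ i, f i) / (Fintype.card ι : ℝ) :=
    div_nonneg (sum_nonneg fun i _ => hf i) hN.le
  have := Real.rpow_le_rpow (by positivity) hpow (by positivity : (0 : ℝ) ≤ 1 / (2 * m))
  refine le_trans (le_of_eq ?_) this
  have h2 := Real.pow_rpow_inv_natCast h0 (by omega : 2 * m ≠ 0)
  rw [one_div, ← Nat.cast_ofNat (R := ℝ) (n := 2), ← Nat.cast_mul, h2]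

end Schreier

/-- Let `k ≥ 2`, `d ≥ 1`, `n = 2^k − 1`, and let `s₁, …, s_d` be
independent uniform random elements of `GL_k(F₂)`. Let `μ s 1` be the second largest
(in absolute value) eigenvalue of the normalized adjacency matrix of the degree-`2d`
Schreier graph of `s₁, …, s_d` acting on the nonzero vectors of `F₂^k`. With
`x₃(i) = X₃(1, 2m−2i, d−i)` and `x₄(i) = X₄(0, 2m−2i, d−i)`, for every positive
integer `m`,
`E(|μ₂|) ≤ ((1/(2d))^{2m}·n·[Σ_{i=1}^{m} C(d,i)·((2m)!/(2m−2i)!)·((2^i−1)·(x₃(i)+x₄(i))·(2/n) + (x₃(i)+x₄(i))·(1/n) + (2^i/(i+1)!)·(x₃(i)·(5/n) + x₄(i))) + X₁(1,2m,d)·(1/n) + x₃(0)·(5/n) + x₄(0)] − 1)^{1/(2m)}`. -/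
theorem stmt2
    {k d n m : ℕ} (hk : 2 ≤ k) (hd : 1 ≤ d) (hn : n = 2 ^ k - 1) (hm : 0 < m)
    (M : (Fin d → GL (Fin k) (ZMod 2)) →
      Matrix {v : Fin k → ZMod 2 // v ≠ 0} {v : Fin k → ZMod 2 // v ≠ 0} ℝ)
    (hM : ∀ s x y, M s x y =
      (((Finset.univ.filter fun i : Fin d =>
          (s i : Matrix (Fin k) (Fin k) (ZMod 2)).mulVec x.val = y.val).card : ℝ)
        + ((Finset.univ.filter fun i : Fin d =>
          ((s i)⁻¹ : Matrix (Fin k) (Fin k) (ZMod 2)).mulVec x.val = y.val).card : ℝ))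
        / (2 * d))
    (μ : (Fin d → GL (Fin k) (ZMod 2)) → Fin n → ℝ)
    (hμ : ∀ s, ∃ hsym : (M s).IsHermitian, ∃ e : Fin n ≃ {v : Fin k → ZMod 2 // v ≠ 0},
      (∀ i, μ s i = hsym.eigenvalues (e i)) ∧
      (∀ i j : Fin n, i ≤ j → |μ s j| ≤ |μ s i|) ∧
      μ s ⟨0, by
      have h4 : 4 ≤ 2 ^ k := by
        calc (4:ℕ) = 2 ^ 2 := rfl
        _ ≤ 2 ^ k := Nat.pow_le_pow_right (by norm_num) hk
      omega⟩ = 1) :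
    (∑ s : Fin d → GL (Fin k) (ZMod 2), |μ s ⟨1, by
      have h4 : 4 ≤ 2 ^ k := by
        calc (4:ℕ) = 2 ^ 2 := rfl
        _ ≤ 2 ^ k := Nat.pow_le_pow_right (by norm_num) hk
      omega⟩|)
        / (Fintype.card (GL (Fin k) (ZMod 2)) : ℝ) ^ d
      ≤ ((1 / (2 * d : ℝ)) ^ (2 * m) * n *
          ((∑ i ∈ Finset.Icc 1 m, (d.choose i : ℝ) *
            ((Nat.factorial (2 * m) : ℝ) / (Nat.factorial (2 * m - 2 * i) : ℝ)) *
            (((2 : ℝ) ^ i - 1) *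
                (Xrec 3 1 (2 * m - 2 * i) (d - i) + Xrec 4 0 (2 * m - 2 * i) (d - i)) *
                (2 / n)
              + ((Xrec 3 1 (2 * m - 2 * i) (d - i) + Xrec 4 0 (2 * m - 2 * i) (d - i))
                  * (1 / n)
                + ((2 : ℝ) ^ i / (Nat.factorial (i + 1) : ℝ)) *
                  (Xrec 3 1 (2 * m - 2 * i) (d - i) * (5 / n)
                    + Xrec 4 0 (2 * m - 2 * i) (d - i)))))
          + Xrec 1 1 (2 * m) d * (1 / n)
          + Xrec 3 1 (2 * m) d * (5 / n) + Xrec 4 0 (2 * m) d) - 1) ^ ((1 : ℝ) / (2 * m)) := by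
  classical
  have h4 : 2 ^ 2 ≤ 2 ^ k := Nat.pow_le_pow_right (by norm_num) hk
  have hc : Fintype.card {v : Fin k → ZMod 2 // v ≠ 0} = n := (card_nonzero k).trans hn.symm
  have hn0 : (n : ℝ) ≠ 0 := by
    have : n ≠ 0 := by omega
    exact_mod_cast this
  have hcard : (Fintype.card (Fin d → GL (Fin k) (ZMod 2)) : ℝ) =
      (Fintype.card (GL (Fin k) (ZMod 2)) : ℝ) ^ d := by simp
  rw [← hcard]
  refine mean_le_rpow_of_sum_pow_le (fun s => abs_nonneg _) hm ?_
  have htr := sum_trace_pow (G := GL (Fin k) (ZMod 2)) (Ω := {v : Fin k → ZMod 2 // v ≠ 0})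
    (β := Fin d) (1 / (2 * d : ℝ)) (2 * m)
  have hfix := (gl_transitivityBounds hk).sum_sum_totalFix_le (β := Fin d) m
  have h31 := sum_pairWeight_le (β := Fin d) (L := 2 * m) m 3 1 le_rfl 5 (by norm_num)
  have h40 := sum_pairWeight_le (β := Fin d) (L := 2 * m) m 4 0 (by norm_num) n (by positivity)
  rw [hc] at hfix
  rw [Fintype.card_fin] at hfix h31 h40
  calc _ ≤ ∑ s, (M s ^ (2 * m)).trace := Finset.sum_le_sum fun s _ => by
        obtain ⟨hsym, e, he, -, h1⟩ := hμ s
        exact one_add_abs_pow_le_trace_pow hsym e he (by simp [Fin.ext_iff]) h1 m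
    _ = _ := by
        simp_rw [fun s => schreier_eq_smul_sum_permMatrix s (M s) (hM s)]
        exact htr
    _ ≤ (1 / (2 * d : ℝ)) ^ (2 * m) * _ := mul_le_mul_of_nonneg_left
        (hfix.trans (mul_le_mul_of_nonneg_left (add_le_add (add_le_add_right h31 _) h40)
          (by positivity))) (by positivity)
    _ = _ := by
        rw [hcard, mul_left_comm, mul_assoc _ (n : ℝ)]
        congr 2
        rw [show ∀ x a S b T : ℝ, x + (a + S) + (b + T) = S + T + (x + (a + b)) by
          intros; ring, ← Finset.sum_add_distrib, mul_add, mul_add, mul_add, add_assoc, add_assoc,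
          Finset.mul_sum]
        refine congrArg₂ (· + ·) (Finset.sum_congr rfl fun i _ => ?_) ?_
        · field_simp
          ring
        · field_simp
end
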